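/- arXiv:0911.1268 — 13 statements merged into one kernel-verified Lean document; each statement's English description precedes it below -/
import Mathlib

section
/- Let n ≥ 1, let a₁,…,aₙ be nonzero rational numbers, and for each j let r_j ∈ ℂ be a complex number with r_j⁴ = a_j. Let F be the subfield of ℂ generated over ℚ by i together with r₁,…,rₙ. Then there exists x ∈ F with x⁴ = 2 if and only if the class of 2 or the class of −2 belongs to the subgroup of ℚˣ/(ℚˣ)⁴ generated by the classes of a₁,…,aₙ. -/
/-- If `K` contains the `n`-th roots of unity and `y ^ n ∈ K`, then `σ ↦ σ y / y` is a character of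
the group of `K`-automorphisms. -/
theorem exists_kummer_character {K L : Type*} [Field K] [Field L] [Algebra K L] {n : ℕ} [NeZero n]
    {ζ : K} (hζ : IsPrimitiveRoot ζ n) {y : L} (hy : y ≠ 0)
    (hyn : y ^ n ∈ Set.range (algebraMap K L)) :
    ∃ f : (L ≃ₐ[K] L) →* L, ∀ σ, σ y = f σ * y := by
  have fixed (σ τ : L ≃ₐ[K] L) : σ (τ y / y) = τ y / y := by
    obtain ⟨c, hc⟩ := hyn
    have hpow : (τ y / y) ^ n = 1 := by
      rw [div_pow, ← map_pow, ← hc, AlgEquiv.commutes, div_self]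
      exact hc ▸ pow_ne_zero n hy
    obtain ⟨i, -, hi⟩ :=
      (hζ.map_of_injective (algebraMap K L).injective).eq_pow_of_pow_eq_one hpow
    rw [← hi, ← map_pow, AlgEquiv.commutes]
  refine ⟨⟨⟨fun σ => σ y / y, by simp [hy]⟩, fun σ τ => ?_⟩, fun σ => ?_⟩
  · have h : σ (τ y) = τ y / y * σ y := by
      conv_lhs => rw [← div_mul_cancel₀ (τ y) hy, map_mul, fixed]
    simp only [AlgEquiv.mul_apply, h]
    ring
  · simp [hy]

/-- Kummer theory: over a field containing the `n`-th roots of unity, an `n`-th root `x` of an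
element of `K` in the span of a monoid of such roots is a `K`-multiple of an element of the
monoid. -/
theorem exists_eq_algebraMap_mul_of_mem_span {K L : Type*} [Field K] [Field L] [Algebra K L]
    [IsGalois K L] {n : ℕ} [NeZero n] {ζ : K} (hζ : IsPrimitiveRoot ζ n) (M : Submonoid L)
    (hM0 : ∀ m ∈ M, m ≠ 0) (hM : ∀ m ∈ M, m ^ n ∈ Set.range (algebraMap K L))
    {x : L} (hx0 : x ≠ 0) (hxn : x ^ n ∈ Set.range (algebraMap K L))
    (hx : x ∈ Submodule.span K (M : Set L)) :
    ∃ m ∈ M, ∃ k : K, x = algebraMap K L k * m := by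
  obtain ⟨f, hf⟩ := exists_kummer_character hζ hx0 hxn
  let s : Set ((L ≃ₐ[K] L) →* L) := {g | ∃ m ∈ M, ∀ σ, σ m = g σ * m}
  let v : ((L ≃ₐ[K] L) →* L) → (L ≃ₐ[K] L) → L := fun g => g
  have orbit : (fun σ : L ≃ₐ[K] L => σ x) ∈ Submodule.span L (v '' s) := by
    clear hf hxn hx0
    induction hx using Submodule.span_induction with
    | mem m hm =>
      obtain ⟨g, hg⟩ := exists_kummer_character hζ (hM0 m hm) (hM m hm)
      have : (fun σ : L ≃ₐ[K] L => σ m) = m • v g := by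
        ext σ
        simp [hg, v, mul_comm]
      rw [this]
      exact Submodule.smul_mem _ _ (Submodule.subset_span ⟨g, ⟨m, hm, hg⟩, rfl⟩)
    | zero =>
      have : (fun σ : L ≃ₐ[K] L => σ 0) = 0 := by
        ext σ
        simp
      rw [this]
      exact Submodule.zero_mem _
    | add y z _ _ hy hz =>
      have : (fun σ : L ≃ₐ[K] L => σ (y + z)) = (fun σ => σ y) + fun σ => σ z := by
        ext σ
        simp
      rw [this]
      exact Submodule.add_mem _ hy hz
    | smul k y _ hy =>
      have : (fun σ : L ≃ₐ[K] L => σ (k • y)) = algebraMap K L k • fun σ => σ y := by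
        ext σ
        simp [Algebra.smul_def]
      rw [this]
      exact Submodule.smul_mem _ _ hy
  have hfs : f ∈ s := by
    by_contra hfs
    refine (linearIndependent_monoidHom (L ≃ₐ[K] L) L).notMem_span_image hfs ?_
    have : v f = x⁻¹ • fun σ : L ≃ₐ[K] L => σ x := by
      ext σ
      simp only [v, Pi.smul_apply, smul_eq_mul, hf]
      field_simp
    exact (this ▸ Submodule.smul_mem _ _ orbit : v f ∈ Submodule.span L (v '' s))
  obtain ⟨m, hm, hfm⟩ := hfs
  have hm0 := hM0 m hm
  have hbot : x / m ∈ (⊥ : IntermediateField K L) := by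
    refine (InfiniteGalois.mem_bot_iff_fixed _).2 fun σ => ?_
    have hfσ : f σ ≠ 0 := fun h => hx0 (by simpa [h] using hf σ)
    rw [map_div₀, hf, hfm, mul_div_mul_left _ _ hfσ]
  obtain ⟨k, hk⟩ := IntermediateField.mem_bot.1 hbot
  exact ⟨m, hm, k, by rw [hk, div_mul_cancel₀ _ hm0]⟩

theorem exists_rat_add_rat_mul_I {z : ℂ} (hz : z ∈ IntermediateField.adjoin ℚ {Complex.I}) :
    ∃ p q : ℚ, z = p + q * Complex.I := by
  rw [← IntermediateField.mem_toSubalgebra,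
    IntermediateField.adjoin_simple_toSubalgebra_of_isAlgebraic
      Complex.isIntegral_rat_I.isAlgebraic] at hz
  induction hz using Algebra.adjoin_induction with
  | mem x hx => exact ⟨0, 1, by simpa using hx⟩
  | algebraMap c => exact ⟨c, 0, by simp⟩
  | add x y _ _ hx hy =>
    obtain ⟨p, q, rfl⟩ := hx
    obtain ⟨p', q', rfl⟩ := hy
    exact ⟨p + p', q + q', by push_cast; ring⟩
  | mul x y _ _ hx hy =>
    obtain ⟨p, q, rfl⟩ := hx
    obtain ⟨p', q', rfl⟩ := hy
    refine ⟨p * p' - q * q', p * q' + q * p', ?_⟩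
    push_cast
    linear_combination (q * q' : ℂ) * Complex.I_sq

/-- A rational number that is a fourth power in `ℚ(i)` is `t ^ 4` or `-4 * t ^ 4` for a
rational `t`. -/
theorem eq_pow_four_or_of_eq_pow_four {z : ℂ} (hz : z ∈ IntermediateField.adjoin ℚ {Complex.I})
    {c : ℚ} (hc : z ^ 4 = c) : ∃ t : ℚ, c = t ^ 4 ∨ c = -4 * t ^ 4 := by
  obtain ⟨p, q, rfl⟩ := exists_rat_add_rat_mul_I hz
  have key : ((p ^ 4 - 6 * p ^ 2 * q ^ 2 + q ^ 4 - c : ℚ) : ℂ) +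
      ((4 * p * q * (p ^ 2 - q ^ 2) : ℚ) : ℂ) * Complex.I = 0 := by
    push_cast
    linear_combination hc - (6 * p ^ 2 * q ^ 2 + 4 * p * q ^ 3 * Complex.I +
      q ^ 4 * (Complex.I ^ 2 - 1) : ℂ) * Complex.I_sq
  have hre : p ^ 4 - 6 * p ^ 2 * q ^ 2 + q ^ 4 - c = 0 := by
    have := congrArg Complex.re key
    simp only [Complex.add_re, Complex.mul_re, Complex.ratCast_re, Complex.ratCast_im,
      Complex.I_re, Complex.I_im, Complex.zero_re] at this
    have h : ((p ^ 4 - 6 * p ^ 2 * q ^ 2 + q ^ 4 - c : ℚ) : ℝ) = 0 := by linarith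
    exact_mod_cast h
  have him : 4 * p * q * (p ^ 2 - q ^ 2) = 0 := by
    have := congrArg Complex.im key
    simp only [Complex.add_im, Complex.mul_im, Complex.ratCast_re, Complex.ratCast_im,
      Complex.I_re, Complex.I_im, Complex.zero_im] at this
    have h : ((4 * p * q * (p ^ 2 - q ^ 2) : ℚ) : ℝ) = 0 := by linarith
    exact_mod_cast h
  rcases mul_eq_zero.1 him with h | h
  · rcases mul_eq_zero.1 h with h | rfl
    · obtain rfl : p = 0 := by linarith
      exact ⟨q, Or.inl (by linear_combination -hre)⟩
    · exact ⟨p, Or.inl (by linear_combination -hre)⟩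
  · exact ⟨p, Or.inr (by linear_combination -hre + (5 * p ^ 2 - q ^ 2) * h)⟩

/-- If a class lies in the subgroup generated by the classes of the `a j`, then its representatives
have fourth roots in any subfield containing fourth roots of the `a j`. -/
theorem exists_pow_four_eq_of_mk_mem_closure {ι : Type*} {a : ι → ℚˣ} {r : ι → ℂ}
    (hr : ∀ j, r j ^ 4 = (a j : ℚ)) {F : Subfield ℂ} (hF : ∀ j, r j ∈ F) {u : ℚˣ}
    (hu : (QuotientGroup.mk u : ℚˣ ⧸ (powMonoidHom 4 : ℚˣ →* ℚˣ).range) ∈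
      Subgroup.closure (Set.range fun j => QuotientGroup.mk (a j))) :
    ∃ y ∈ F, y ^ 4 = ((u : ℚ) : ℂ) := by
  have key : ∀ g ∈ Subgroup.closure (Set.range fun j =>
      (QuotientGroup.mk (a j) : ℚˣ ⧸ (powMonoidHom 4 : ℚˣ →* ℚˣ).range)),
      ∃ w : ℚˣ, QuotientGroup.mk w = g ∧ ∃ y ∈ F, y ^ 4 = ((w : ℚ) : ℂ) := by
    intro g hg
    induction hg using Subgroup.closure_induction with
    | mem g hg =>
      obtain ⟨j, rfl⟩ := hg
      exact ⟨a j, rfl, r j, hF j, hr j⟩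
    | one => exact ⟨1, rfl, 1, F.one_mem, by simp⟩
    | mul g h _ _ hg hh =>
      obtain ⟨w, rfl, y, hy, hyw⟩ := hg
      obtain ⟨w', rfl, y', hy', hyw'⟩ := hh
      exact ⟨w * w', rfl, y * y', F.mul_mem hy hy', by simp [mul_pow, hyw, hyw']⟩
    | inv g _ hg =>
      obtain ⟨w, rfl, y, hy, hyw⟩ := hg
      exact ⟨w⁻¹, rfl, y⁻¹, F.inv_mem hy, by simp [hyw]⟩
  obtain ⟨w, hwu, y, hy, hyw⟩ := key _ hu
  obtain ⟨t, ht⟩ := QuotientGroup.eq.1 hwu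
  have hut : u = w * t ^ 4 := by
    rw [← powMonoidHom_apply, ht, mul_inv_cancel_left]
  refine ⟨y * ((t : ℚ) : ℂ), F.mul_mem hy (SubfieldClass.ratCast_mem F _), ?_⟩
  rw [mul_pow, hyw, hut]
  push_cast
  rfl

/-- A fourth root `x` of a rational number in the field generated by `i` and fourth roots of the
rational numbers `a j` is a product of an element of `ℚ(i)` and a fourth root of an element of the
subgroup generated by the `a j`. -/
theorem exists_eq_mul_of_mem_subfield_closure {ι : Type*} {a : ι → ℚˣ} {r : ι → ℂ}
    (hr : ∀ j, r j ^ 4 = (a j : ℚ)) {x : ℂ}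
    (hx : x ∈ Subfield.closure (insert Complex.I (Set.range r))) {c : ℚ} (hc : c ≠ 0)
    (hxc : x ^ 4 = c) :
    ∃ k ∈ IntermediateField.adjoin ℚ {Complex.I}, ∃ u ∈ Subgroup.closure (Set.range a),
      k ^ 4 * ((u : ℚ) : ℂ) = c := by
  let K := IntermediateField.adjoin ℚ {Complex.I}
  let L := algebraicClosure K ℂ
  have hIK : Complex.I ∈ K := IntermediateField.mem_adjoin_simple_self ℚ _
  have hζ : IsPrimitiveRoot (⟨Complex.I, hIK⟩ : K) 4 := by
    refine IsPrimitiveRoot.of_map_of_injective (f := algebraMap K ℂ) ?_ (algebraMap K ℂ).injective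
    exact Complex.isPrimitiveRoot_I
  have mem_L {y : ℂ} {b : ℚ} (hy : y ^ 4 = b) : y ∈ L := by
    refine mem_algebraicClosure_iff.2 (IsAlgebraic.of_pow (n := 4) (by norm_num) ?_)
    rw [hy]
    simpa using isAlgebraic_algebraMap (R := K) (A := ℂ) (b : K)
  let r' : ι → L := fun j => ⟨r j, mem_L (hr j)⟩
  have hadj : x ∈ IntermediateField.adjoin K (Set.range r) := by
    refine (Subfield.closure_le (t := (IntermediateField.adjoin K (Set.range r)).toSubfield)).2
      (Set.insert_subset ?_ ?_) hx
    · exact (IntermediateField.adjoin K (Set.range r)).algebraMap_mem ⟨Complex.I, hIK⟩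
    · exact IntermediateField.subset_adjoin K _
  have hrange : Set.range r = L.val '' Set.range r' := by
    rw [← Set.range_comp]
    rfl
  rw [hrange, ← IntermediateField.adjoin_map] at hadj
  obtain ⟨x', hx', rfl⟩ := hadj
  have hspan : x' ∈ Submodule.span K (Submonoid.closure (Set.range r') : Set L) := by
    change x' ∈ IntermediateField.adjoin K (Set.range r') at hx'
    rw [← IntermediateField.mem_toSubalgebra,
      IntermediateField.adjoin_toSubalgebra] at hx'
    rwa [← Algebra.adjoin_eq_span]
  have hM : ∀ m ∈ Submonoid.closure (Set.range r'),
      ∃ u ∈ Subgroup.closure (Set.range a), (m : ℂ) ^ 4 = ((u : ℚ) : ℂ) := by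
    intro m hm
    induction hm using Submonoid.closure_induction with
    | mem m hm =>
      obtain ⟨j, rfl⟩ := hm
      exact ⟨a j, Subgroup.subset_closure ⟨j, rfl⟩, hr j⟩
    | one => exact ⟨1, one_mem _, by simp⟩
    | mul m m' _ _ hm hm' =>
      obtain ⟨u, hu, hmu⟩ := hm
      obtain ⟨u', hu', hmu'⟩ := hm'
      exact ⟨u * u', mul_mem hu hu', by simp [mul_pow, hmu, hmu']⟩
  have pow_mem {y : L} {b : ℚ} (hy : (y : ℂ) ^ 4 = b) : y ^ 4 ∈ Set.range (algebraMap K L) :=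
    ⟨b, Subtype.ext (by simpa using hy.symm)⟩
  obtain ⟨m, hm, k, hk⟩ := exists_eq_algebraMap_mul_of_mem_span hζ _
    (fun m hm h => by
      obtain ⟨u, -, hu⟩ := hM m hm
      exact u.ne_zero (by simpa [h] using hu.symm))
    (fun m hm => by
      obtain ⟨u, -, hu⟩ := hM m hm
      exact pow_mem hu)
    (x := x') (fun h => hc (by simpa [h] using hxc.symm)) (pow_mem hxc) hspan
  obtain ⟨u, hu, hmu⟩ := hM m hm
  refine ⟨k, k.2, u, hu, ?_⟩
  rw [← hxc, hk, ← hmu, ← mul_pow]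
  rfl

/-- Lemma 5.4 (1)⟺(2): for nonzero rationals `a₁,…,aₙ` with chosen fourth roots
`r j`, the field `ℚ(i, r₁, …, rₙ) ⊆ ℂ` contains a fourth root of `2` iff the class
of `2` or of `-2` lies in the subgroup of `ℚˣ/(ℚˣ)⁴` generated by the classes of the `a j`. -/
theorem stmt0 (n : ℕ) (hn : 1 ≤ n) (a : Fin n → ℚ) (ha : ∀ j, a j ≠ 0)
    (r : Fin n → ℂ) (hr : ∀ j, (r j) ^ 4 = (a j : ℂ)) :
    (∃ x ∈ Subfield.closure (insert Complex.I (Set.range r)), x ^ 4 = 2) ↔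
      ((QuotientGroup.mk (Units.mk0 (2 : ℚ) (by norm_num)) :
          ℚˣ ⧸ (powMonoidHom 4 : ℚˣ →* ℚˣ).range) ∈
        Subgroup.closure
          (Set.range fun j => (QuotientGroup.mk (Units.mk0 (a j) (ha j)) :
            ℚˣ ⧸ (powMonoidHom 4 : ℚˣ →* ℚˣ).range)) ∨
       (QuotientGroup.mk (Units.mk0 (-2 : ℚ) (by norm_num)) :
          ℚˣ ⧸ (powMonoidHom 4 : ℚˣ →* ℚˣ).range) ∈
        Subgroup.closure
          (Set.range fun j => (QuotientGroup.mk (Units.mk0 (a j) (ha j)) :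
            ℚˣ ⧸ (powMonoidHom 4 : ℚˣ →* ℚˣ).range))) := by
  let α : Fin n → ℚˣ := fun j => Units.mk0 (a j) (ha j)
  have hrα : ∀ j, r j ^ 4 = ((α j : ℚ) : ℂ) := hr
  have hrF (j : Fin n) : r j ∈ Subfield.closure (insert Complex.I (Set.range r)) :=
    Subfield.subset_closure (Or.inr ⟨j, rfl⟩)
  constructor
  · rintro ⟨x, hx, hx2⟩
    obtain ⟨k, hk, u, hu, hku⟩ := exists_eq_mul_of_mem_subfield_closure hrα hx
      (c := 2) two_ne_zero (by simpa using hx2)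
    have hu0 : (u : ℚ) ≠ 0 := u.ne_zero
    have hmk : (QuotientGroup.mk u : ℚˣ ⧸ (powMonoidHom 4 : ℚˣ →* ℚˣ).range) ∈
        Subgroup.closure (Set.range fun j => QuotientGroup.mk (α j)) := by
      have := Subgroup.mem_map_of_mem (QuotientGroup.mk' (powMonoidHom 4 : ℚˣ →* ℚˣ).range) hu
      rwa [MonoidHom.map_closure, ← Set.range_comp] at this
    have hk4 : k ^ 4 = ((2 / u : ℚ) : ℂ) := by
      have : ((u : ℚ) : ℂ) ≠ 0 := by exact_mod_cast hu0
      push_cast at hku ⊢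
      rw [eq_div_iff this, hku]
    obtain ⟨t, ht | ht⟩ := eq_pow_four_or_of_eq_pow_four hk hk4
    · left
      rw [div_eq_iff hu0] at ht
      have ht0 : t ≠ 0 := by
        rintro rfl
        norm_num at ht
      convert hmk using 1
      refine (QuotientGroup.eq.2 (MonoidHom.mem_range.2 ⟨Units.mk0 t ht0, ?_⟩)).symm
      rw [eq_inv_mul_iff_mul_eq]
      ext
      simp [ht, mul_comm]
    · right
      rw [div_eq_iff hu0] at ht
      have ht0 : t ≠ 0 := by
        rintro rfl
        norm_num at ht
      convert inv_mem hmk using 1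
      rw [← QuotientGroup.mk_inv]
      refine (QuotientGroup.eq.2 (MonoidHom.mem_range.2 ⟨(Units.mk0 t ht0)⁻¹, ?_⟩)).symm
      ext
      simp only [powMonoidHom_apply, Units.val_pow_eq_pow_val, Units.val_inv_eq_inv_val,
        Units.val_mk0, inv_inv, Units.val_mul]
      field_simp
      linarith
  · rintro (h | h)
    · obtain ⟨y, hy, hy4⟩ := exists_pow_four_eq_of_mk_mem_closure hrα hrF h
      exact ⟨y, hy, by simpa using hy4⟩
    · obtain ⟨y, hy, hy4⟩ := exists_pow_four_eq_of_mk_mem_closure hrα hrF h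
      have hI : Complex.I ∈ Subfield.closure (insert Complex.I (Set.range r)) :=
        Subfield.subset_closure (Set.mem_insert _ _)
      have hI4 : (1 + Complex.I) ^ 4 = -4 := by
        linear_combination (Complex.I ^ 2 + 4 * Complex.I + 5) * Complex.I_sq
      refine ⟨(1 + Complex.I) / y, div_mem (add_mem (one_mem _) hI) hy, ?_⟩
      rw [div_pow, hy4, hI4]
      norm_num
end

section
/- A nonzero rational number q is a fourth power in the field ℚ(i) (the subfield of ℂ generated over ℚ by i) if and only if q ∈ (ℚˣ)⁴ or −4q ∈ (ℚˣ)⁴. Equivalently, the kernel of the natural map ℚˣ/(ℚˣ)⁴ → ℚ(i)ˣ/(ℚ(i)ˣ)⁴ is the subgroup of order 2 generated by the class of −4. -/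
theorem Complex.mem_subfieldClosure_I_iff {x : ℂ} :
    x ∈ Subfield.closure ({Complex.I} : Set ℂ) ↔ ∃ a b : ℚ, x = a + b * Complex.I := by
  constructor
  · intro hx
    induction hx using Subfield.closure_induction with
    | mem x hx => exact ⟨0, 1, by simpa using hx⟩
    | one => exact ⟨1, 0, by simp⟩
    | add x y _ _ hx hy =>
      obtain ⟨a, b, rfl⟩ := hx
      obtain ⟨c, d, rfl⟩ := hy
      exact ⟨a + c, b + d, by push_cast; ring⟩
    | neg x _ hx =>
      obtain ⟨a, b, rfl⟩ := hx
      exact ⟨-a, -b, by push_cast; ring⟩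
    | inv x _ hx =>
      obtain ⟨a, b, rfl⟩ := hx
      refine ⟨a / (a ^ 2 + b ^ 2), -b / (a ^ 2 + b ^ 2), ?_⟩
      by_cases h : a ^ 2 + b ^ 2 = 0
      · obtain rfl : a = 0 := by nlinarith [sq_nonneg a, sq_nonneg b]
        obtain rfl : b = 0 := by nlinarith [sq_nonneg b]
        simp
      · have h' : (a : ℂ) ^ 2 + (b : ℂ) ^ 2 ≠ 0 := by exact_mod_cast h
        apply inv_eq_of_mul_eq_one_right
        push_cast
        field_simp
        linear_combination (-(b : ℂ) ^ 2) * Complex.I_sq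
    | mul x y _ _ hx hy =>
      obtain ⟨a, b, rfl⟩ := hx
      obtain ⟨c, d, rfl⟩ := hy
      refine ⟨a * c - b * d, a * d + b * c, ?_⟩
      push_cast
      linear_combination ((b : ℂ) * d) * Complex.I_sq
  · rintro ⟨a, b, rfl⟩
    exact add_mem (SubfieldClass.ratCast_mem _ a)
      (mul_mem (SubfieldClass.ratCast_mem _ b) (Subfield.subset_closure rfl))

/-- A nonzero rational `q` is a fourth power in `ℚ(i) ⊆ ℂ` iff `q` or `-4q` is a
fourth power in `ℚ`. (Claim from the proof of Lemma 5.4, using `-4 = (2/(1+i))⁴`.) -/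
theorem stmt2 (q : ℚ) (hq : q ≠ 0) :
    (∃ x ∈ Subfield.closure ({Complex.I} : Set ℂ), x ^ 4 = (q : ℂ)) ↔
      ((∃ r : ℚ, q = r ^ 4) ∨ (∃ r : ℚ, -4 * q = r ^ 4)) := by
  simp only [Complex.mem_subfieldClosure_I_iff]
  constructor
  · rintro ⟨_, ⟨a, b, rfl⟩, h⟩
    have expand : ((a ^ 4 - 6 * a ^ 2 * b ^ 2 + b ^ 4 : ℚ) : ℂ) +
        ((4 * a * b * (a ^ 2 - b ^ 2) : ℚ) : ℂ) * Complex.I = (q : ℂ) := by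
      rw [← h]
      push_cast
      linear_combination (-(6 * (a : ℂ) ^ 2 * b ^ 2 + 4 * a * b ^ 3 * Complex.I +
        b ^ 4 * (Complex.I ^ 2 - 1))) * Complex.I_sq
    have hre : a ^ 4 - 6 * a ^ 2 * b ^ 2 + b ^ 4 = q := by
      have := congrArg Complex.re expand
      simp only [Complex.add_re, Complex.mul_I_re, Complex.ratCast_re, Complex.ratCast_im,
        neg_zero, add_zero] at this
      exact_mod_cast this
    have him : 4 * a * b * (a ^ 2 - b ^ 2) = 0 := by
      have := congrArg Complex.im expand
      simp only [Complex.add_im, Complex.mul_I_im, Complex.ratCast_re, Complex.ratCast_im,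
        zero_add] at this
      exact_mod_cast this
    rcases mul_eq_zero.mp him with hab | hab
    · left
      rcases mul_eq_zero.mp hab with ha | rfl
      · obtain rfl : a = 0 := by linarith
        exact ⟨b, by linear_combination -hre⟩
      · exact ⟨a, by linear_combination -hre⟩
    · right
      exact ⟨2 * a, by linear_combination 4 * hre + (-20 * a ^ 2 + 4 * b ^ 2) * hab⟩
  · rintro (⟨r, rfl⟩ | ⟨r, hr⟩)
    · exact ⟨r, ⟨r, 0, by simp⟩, by push_cast; rfl⟩
    · refine ⟨_, ⟨r / 2, r / 2, rfl⟩, ?_⟩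
      have hr' : -4 * (q : ℂ) = (r : ℂ) ^ 4 := by exact_mod_cast hr
      push_cast
      linear_combination (1 / 4 : ℂ) * hr' +
        (r : ℂ) ^ 4 / 16 * (Complex.I ^ 2 + 4 * Complex.I + 5) * Complex.I_sq
end

section
/- Let F ⊆ E be fields of characteristic ≠ 2 such that F contains an element i with i² = −1, E contains an element s with s² = 2, and E is generated over F by s. If no element of F has fourth power equal to 2, then no element of E has fourth power equal to 2. -/
/-- Every element of the field generated by a subfield `F` and an element `s` with `s ^ 2 ∈ F`
has the form `a + b * s` with `a, b ∈ F`. -/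
theorem Subfield.exists_add_mul_of_mem_closure_union_singleton {E : Type*} [Field E]
    {F : Subfield E} {s : E} (hs : s ^ 2 ∈ F) {x : E}
    (hx : x ∈ Subfield.closure ((F : Set E) ∪ {s})) :
    ∃ a ∈ F, ∃ b ∈ F, x = a + b * s := by
  induction hx using Subfield.closure_induction with
  | mem x hx =>
    rcases hx with hx | rfl
    · exact ⟨x, hx, 0, F.zero_mem, by ring⟩
    · exact ⟨0, F.zero_mem, 1, F.one_mem, by ring⟩
  | one => exact ⟨1, F.one_mem, 0, F.zero_mem, by ring⟩
  | add x y _ _ hx hy =>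
    obtain ⟨a, ha, b, hb, rfl⟩ := hx
    obtain ⟨c, hc, d, hd, rfl⟩ := hy
    exact ⟨a + c, F.add_mem ha hc, b + d, F.add_mem hb hd, by ring⟩
  | neg x _ hx =>
    obtain ⟨a, ha, b, hb, rfl⟩ := hx
    exact ⟨-a, F.neg_mem ha, -b, F.neg_mem hb, by ring⟩
  | inv x _ hx =>
    obtain ⟨a, ha, b, hb, rfl⟩ := hx
    by_cases hconj : a - b * s = 0
    · refine ⟨(a + a)⁻¹, F.inv_mem (F.add_mem ha ha), 0, F.zero_mem, ?_⟩
      rw [← sub_eq_zero.mp hconj, zero_mul, add_zero]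
    by_cases hzero : a + b * s = 0
    · exact ⟨0, F.zero_mem, 0, F.zero_mem, by simp [hzero]⟩
    have hnorm : a ^ 2 - b ^ 2 * s ^ 2 = (a + b * s) * (a - b * s) := by ring
    have hmem : (a ^ 2 - b ^ 2 * s ^ 2)⁻¹ ∈ F :=
      F.inv_mem (F.sub_mem (F.pow_mem ha 2) (F.mul_mem (F.pow_mem hb 2) hs))
    refine ⟨a * (a ^ 2 - b ^ 2 * s ^ 2)⁻¹, F.mul_mem ha hmem,
      -b * (a ^ 2 - b ^ 2 * s ^ 2)⁻¹, F.mul_mem (F.neg_mem hb) hmem, ?_⟩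
    rw [hnorm]
    field_simp
    ring
  | mul x y _ _ hx hy =>
    obtain ⟨a, ha, b, hb, rfl⟩ := hx
    obtain ⟨c, hc, d, hd, rfl⟩ := hy
    exact ⟨a * c + b * d * s ^ 2,
      F.add_mem (F.mul_mem ha hc) (F.mul_mem (F.mul_mem hb hd) hs),
      a * d + b * c, F.add_mem (F.mul_mem ha hd) (F.mul_mem hb hc), by ring⟩


/-- Lemma 5.9 part 1: if `F ⊆ E` are fields of characteristic `≠ 2`, `F` contains
a square root of `-1`, and `E` is generated over `F` by a square root `s` of `2`,
then if `F` contains no fourth root of `2`, neither does `E`. -/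
theorem stmt3 {E : Type*} [Field E] (hchar : (2 : E) ≠ 0) (F : Subfield E)
    (i : E) (hiF : i ∈ F) (hi : i ^ 2 = -1)
    (s : E) (hs : s ^ 2 = 2)
    (hgen : Subfield.closure ((F : Set E) ∪ {s}) = ⊤)
    (hF : ∀ x ∈ F, x ^ 4 ≠ 2) :
    ∀ x : E, x ^ 4 ≠ 2 := by
  intro x hx
  have h_two : (2 : E) ∈ F := ofNat_mem F 2
  have mem_top (y : E) : y ∈ Subfield.closure ((F : Set E) ∪ {s}) := hgen ▸ Subfield.mem_top y
  have hsF : s ∉ F := fun h ↦ by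
    obtain ⟨a, ha, b, hb, rfl⟩ :=
      Subfield.exists_add_mul_of_mem_closure_union_singleton (hs ▸ h_two) (mem_top x)
    exact hF _ (F.add_mem ha (F.mul_mem hb h)) hx
  have coeff_eq_zero {a b : E} (ha : a ∈ F) (hb : b ∈ F) (h : a + b * s = 0) : b = 0 := by
    by_contra hb0
    have : s = -a / b := by
      field_simp
      linear_combination h
    exact hsF (this ▸ F.div_mem (F.neg_mem ha) hb)
  obtain ⟨a, ha, b, hb, rfl⟩ :=
    Subfield.exists_add_mul_of_mem_closure_union_singleton (hs ▸ h_two) (mem_top x)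
  obtain ⟨e, he, he1, hsq⟩ : ∃ e ∈ F, e ≠ 0 ∧ (a + b * s) ^ 2 = e * s := by
    have : ((a + b * s) ^ 2) ^ 2 = s ^ 2 := by linear_combination hx - hs
    rcases sq_eq_sq_iff_eq_or_eq_neg.mp this with h | h
    · exact ⟨1, F.one_mem, one_ne_zero, by rw [h, one_mul]⟩
    · exact ⟨-1, F.neg_mem F.one_mem, neg_ne_zero.mpr one_ne_zero, by rw [h, neg_one_mul]⟩
  have hreal : a ^ 2 + 2 * b ^ 2 ∈ F :=
    F.add_mem (F.pow_mem ha 2) (F.mul_mem h_two (F.pow_mem hb 2))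
  have hcoeff : 2 * a * b - e = 0 :=
    coeff_eq_zero hreal (F.sub_mem (F.mul_mem (F.mul_mem h_two ha) hb) he)
      (by linear_combination hsq - b ^ 2 * hs)
  have hb0 : b ≠ 0 := by
    rintro rfl
    exact he1 (by linear_combination -hcoeff)
  have hi0 : i ≠ 0 := by
    rintro rfl
    norm_num at hi
  have hfactor : (a + i * b * s) * (a + -(i * b) * s) = 0 := by
    linear_combination hsq - s * hcoeff - b ^ 2 * s ^ 2 * hi
  have hib : i * b ∈ F := F.mul_mem hiF hb
  rcases mul_eq_zero.mp hfactor with h | h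
  · exact mul_ne_zero hi0 hb0 (coeff_eq_zero ha hib h)
  · exact mul_ne_zero hi0 hb0 (neg_eq_zero.mp (coeff_eq_zero ha (F.neg_mem hib) h))
end

section
/- Let a, b, c, d be nonzero integers and let p be an odd prime not dividing abcd. Let l₁, l₂, l₃, l₄ be integers. Suppose that for complex numbers r₁, r₂, r₃ with r₁⁴ = b/a, r₂⁴ = c/a, r₃⁴ = d/a, no element x of the subfield of ℂ generated over ℚ by i, r₁, r₂, r₃ satisfies x⁴ = 2. Then for any complex numbers s₁, s₂, s₃ with s₁⁴ = p^{l₂−l₁}·b/a, s₂⁴ = p^{l₃−l₁}·c/a, s₃⁴ = p^{l₄−l₁}·d/a, no element x of the subfield of ℂ generated over ℚ by i, s₁, s₂, s₃ satisfies x⁴ = 2. -/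
/-- An element of `F(t)` with `t ^ 2 ∈ F` has the form `c + d * t` with `c, d ∈ F`. -/
theorem exists_add_mul_of_mem_closure_insert {S : Set ℂ} {t x : ℂ}
    (ht : t ^ 2 ∈ Subfield.closure S) (hx : x ∈ Subfield.closure (insert t S)) :
    ∃ c ∈ Subfield.closure S, ∃ d ∈ Subfield.closure S, x = c + d * t := by
  set F := Subfield.closure S
  by_cases htF : t ∈ F
  · refine ⟨x, ?_, 0, zero_mem F, by ring⟩
    exact Subfield.closure_le.2 (Set.insert_subset htF Subfield.subset_closure) hx
  induction hx using Subfield.closure_induction with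
  | mem y hy =>
    rcases hy with rfl | hy
    · exact ⟨0, zero_mem F, 1, one_mem F, by ring⟩
    · exact ⟨y, Subfield.subset_closure hy, 0, zero_mem F, by ring⟩
  | one => exact ⟨1, one_mem F, 0, zero_mem F, by ring⟩
  | add y z _ _ hy hz =>
    obtain ⟨c, hc, d, hd, rfl⟩ := hy
    obtain ⟨c', hc', d', hd', rfl⟩ := hz
    exact ⟨c + c', add_mem hc hc', d + d', add_mem hd hd', by ring⟩
  | neg y _ hy =>
    obtain ⟨c, hc, d, hd, rfl⟩ := hy
    exact ⟨-c, neg_mem hc, -d, neg_mem hd, by ring⟩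
  | inv y _ hy =>
    obtain ⟨c, hc, d, hd, rfl⟩ := hy
    by_cases hd0 : d = 0
    · exact ⟨c⁻¹, inv_mem hc, 0, zero_mem F, by simp [hd0]⟩
    have hne : ∀ e ∈ F, e ≠ d * t := by
      rintro e he rfl
      exact htF (by simpa [hd0] using div_mem he hd)
    have h1 : c - d * t ≠ 0 := sub_ne_zero.2 (hne c hc)
    have h2 : c + d * t ≠ 0 := fun h => hne (-c) (neg_mem hc) (by linear_combination -h)
    have hN : c ^ 2 - d ^ 2 * t ^ 2 ≠ 0 := by
      rw [show c ^ 2 - d ^ 2 * t ^ 2 = (c - d * t) * (c + d * t) by ring]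
      exact mul_ne_zero h1 h2
    have hNF : c ^ 2 - d ^ 2 * t ^ 2 ∈ F :=
      sub_mem (pow_mem hc 2) (mul_mem (pow_mem hd 2) ht)
    refine ⟨c / (c ^ 2 - d ^ 2 * t ^ 2), div_mem hc hNF,
      -d / (c ^ 2 - d ^ 2 * t ^ 2), div_mem (neg_mem hd) hNF, ?_⟩
    field_simp
    ring
  | mul y z _ _ hy hz =>
    obtain ⟨c, hc, d, hd, rfl⟩ := hy
    obtain ⟨c', hc', d', hd', rfl⟩ := hz
    exact ⟨c * c' + d * d' * t ^ 2, add_mem (mul_mem hc hc') (mul_mem (mul_mem hd hd') ht),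
      c * d' + d * c', add_mem (mul_mem hc hd') (mul_mem hd hc'), by ring⟩

/-- Kummer theory for a quadratic extension `F(t)` of a field `F` containing `i`: an element
whose fourth power lies in `F` lies in `F` or in `t * F`. -/
theorem mem_or_eq_mul_of_pow_four_mem {S : Set ℂ} {t x : ℂ}
    (hI : Complex.I ∈ Subfield.closure S) (ht : t ^ 2 ∈ Subfield.closure S)
    (hx : x ∈ Subfield.closure (insert t S)) (hx4 : x ^ 4 ∈ Subfield.closure S) :
    x ∈ Subfield.closure S ∨ ∃ y ∈ Subfield.closure S, x = t * y := by
  obtain ⟨c, hc, d, hd, rfl⟩ := exists_add_mul_of_mem_closure_insert ht hx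
  set F := Subfield.closure S
  by_cases htF : t ∈ F
  · exact Or.inl (add_mem hc (mul_mem hd htF))
  by_cases hd0 : d = 0
  · exact Or.inl (by simpa [hd0] using hc)
  by_cases hc0 : c = 0
  · exact Or.inr ⟨d, hd, by rw [hc0]; ring⟩
  exfalso
  have hu : c ^ 4 + 6 * c ^ 2 * d ^ 2 * t ^ 2 + d ^ 4 * (t ^ 2) ^ 2 ∈ F :=
    add_mem (add_mem (pow_mem hc 4) (mul_mem (mul_mem (mul_mem (ofNat_mem F 6) (pow_mem hc 2))
      (pow_mem hd 2)) ht)) (mul_mem (pow_mem hd 4) (pow_mem ht 2))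
  have hv : 4 * c * d * (c ^ 2 + d ^ 2 * t ^ 2) ∈ F :=
    mul_mem (mul_mem (mul_mem (ofNat_mem F 4) hc) hd)
      (add_mem (pow_mem hc 2) (mul_mem (pow_mem hd 2) ht))
  have hvt : 4 * c * d * (c ^ 2 + d ^ 2 * t ^ 2) * t ∈ F := by
    convert sub_mem hx4 hu using 1
    ring
  have hv0 : c ^ 2 + d ^ 2 * t ^ 2 = 0 := by
    by_contra h
    have h' : 4 * c * d * (c ^ 2 + d ^ 2 * t ^ 2) ≠ 0 := by simp [hc0, hd0, h]
    exact htF (by simpa [mul_div_cancel_left₀ _ h'] using div_mem hvt hv)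
  have hprod : (d * t - Complex.I * c) * (d * t + Complex.I * c) = 0 := by
    linear_combination hv0 - c ^ 2 * Complex.I_sq
  have key : d * t ∈ F := by
    rcases mul_eq_zero.1 hprod with h | h
    · rw [sub_eq_zero.1 h]
      exact mul_mem hI hc
    · rw [eq_neg_of_add_eq_zero_left h]
      exact neg_mem (mul_mem hI hc)
  exact htF (by simpa [hd0] using div_mem key hd)

/-- Kummer theory for `F(t)` with `t ^ 4 ∈ F` and `i ∈ F`: an element whose fourth power lies
in `F` lies in `t ^ j * F` for some `j < 4`. -/
theorem exists_eq_pow_mul_of_pow_four_mem {S : Set ℂ} {t x : ℂ}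
    (hI : Complex.I ∈ Subfield.closure S) (ht : t ^ 4 ∈ Subfield.closure S)
    (hx : x ∈ Subfield.closure (insert t S)) (hx4 : x ^ 4 ∈ Subfield.closure S) :
    ∃ j < 4, ∃ y ∈ Subfield.closure S, x = t ^ j * y := by
  rcases eq_or_ne t 0 with rfl | ht0
  · exact ⟨0, by norm_num, x, Subfield.closure_le.2
      (Set.insert_subset (zero_mem _) Subfield.subset_closure) hx, by simp⟩
  have hle : Subfield.closure S ≤ Subfield.closure (insert (t ^ 2) S) :=
    Subfield.closure_mono (Set.subset_insert _ _)
  have ht2 : (t ^ 2) ^ 2 ∈ Subfield.closure S := by rwa [← pow_mul]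
  have hx' : x ∈ Subfield.closure (insert t (insert (t ^ 2) S)) :=
    Subfield.closure_mono (Set.insert_subset_insert (Set.subset_insert _ _)) hx
  rcases mem_or_eq_mul_of_pow_four_mem (hle hI)
    (Subfield.subset_closure (Set.mem_insert _ _)) hx' (hle hx4) with h | ⟨y, hy, rfl⟩
  · rcases mem_or_eq_mul_of_pow_four_mem hI ht2 h hx4 with h | ⟨z, hz, rfl⟩
    · exact ⟨0, by norm_num, x, h, by simp⟩
    · exact ⟨2, by norm_num, z, hz, rfl⟩
  · have hy4 : y ^ 4 ∈ Subfield.closure S := by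
      simpa [mul_pow, ht0] using div_mem hx4 ht
    rcases mem_or_eq_mul_of_pow_four_mem hI ht2 hy hy4 with h | ⟨z, hz, rfl⟩
    · exact ⟨1, by norm_num, y, h, by simp⟩
    · exact ⟨3, by norm_num, z, hz, by ring⟩

/-- If the fourth power of an element of `ℚ(i)` is rational, then its valuation at an odd prime
is a multiple of `4`. -/
theorem four_dvd_padicValRat_of_pow_four_eq {p : ℕ} [hp : Fact p.Prime] (hp2 : p ≠ 2) {f : ℂ}
    (hf : f ∈ Subfield.closure {Complex.I}) {u : ℚ} (hfu : f ^ 4 = u) :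
    (4 : ℤ) ∣ padicValRat p u := by
  have hbot : ∀ z ∈ Subfield.closure (∅ : Set ℂ), ∃ q : ℚ, (q : ℂ) = z := by
    intro z hz
    exact (Subfield.closure_le (t := (algebraMap ℚ ℂ).fieldRange)).2 (Set.empty_subset _) hz
  obtain ⟨c, hc, d, hd, rfl⟩ := exists_add_mul_of_mem_closure_insert (S := ∅) (t := Complex.I)
    (by rw [Complex.I_sq]; exact neg_mem (one_mem _)) (by simpa using hf)
  obtain ⟨α, rfl⟩ := hbot c hc
  obtain ⟨β, rfl⟩ := hbot d hd
  have hexp : ((α : ℂ) + β * Complex.I) ^ 4 =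
      ((α ^ 4 - 6 * α ^ 2 * β ^ 2 + β ^ 4 : ℝ) : ℂ)
        + ((4 * α * β * (α ^ 2 - β ^ 2) : ℝ) : ℂ) * Complex.I := by
    have h2 := Complex.I_sq
    have h3 := Complex.I_pow_three
    have h4 := Complex.I_pow_four
    push_cast
    linear_combination 6 * (α : ℂ) ^ 2 * β ^ 2 * h2 + 4 * (α : ℂ) * β ^ 3 * h3
      + (β : ℂ) ^ 4 * h4
  have hru : ((u : ℝ) : ℂ) = u := by norm_cast
  rw [hexp, ← hru] at hfu
  have hre : α ^ 4 - 6 * α ^ 2 * β ^ 2 + β ^ 4 = u := by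
    have h := congrArg Complex.re hfu
    rw [Complex.add_re, Complex.re_ofReal_mul, Complex.ofReal_re, Complex.ofReal_re, Complex.I_re,
      mul_zero, add_zero] at h
    exact_mod_cast h
  have him : 4 * α * β * (α ^ 2 - β ^ 2) = 0 := by
    have h := congrArg Complex.im hfu
    rw [Complex.add_im, Complex.im_ofReal_mul, Complex.ofReal_im, Complex.ofReal_im, Complex.I_im,
      mul_one, zero_add] at h
    exact_mod_cast h
  rcases mul_eq_zero.1 him with h | h
  · rcases mul_eq_zero.1 h with h | h
    · have hα : α = 0 := by simpa using h
      rw [← hre, hα]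
      simp
    · rw [← hre, h]
      simp
  · have hu : u = -(4 * β ^ 4) := by
      rw [← hre]
      linear_combination (α ^ 2 - 5 * β ^ 2) * h
    rcases eq_or_ne β 0 with rfl | hβ
    · simp [hu]
    have h4 : padicValRat p 4 = 0 := by
      have h2 : ¬ p ∣ 2 ^ 2 := fun h =>
        hp2 ((Nat.prime_dvd_prime_iff_eq hp.out Nat.prime_two).1 (hp.out.dvd_of_dvd_pow h))
      rw [show (4 : ℚ) = ((2 ^ 2 : ℕ) : ℚ) by norm_num, padicValRat.of_nat,
        padicValNat.eq_zero_of_not_dvd h2, Nat.cast_zero]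
    rw [hu, padicValRat.neg, padicValRat.mul (by norm_num) (pow_ne_zero 4 hβ), h4, zero_add]
    simp


/-- Lemma 5.9 part 4: if `(a:b:c:d) ∈ W` and `p` is an odd prime not dividing `abcd`,
then `(p^{l₁}a : p^{l₂}b : p^{l₃}c : p^{l₄}d) ∈ W`, where `(a:b:c:d) ∈ W` means that
`ℚ(i, (b/a)^{1/4}, (c/a)^{1/4}, (d/a)^{1/4})` contains no fourth root of `2`. -/
theorem stmt5 (a b c d : ℤ) (ha : a ≠ 0) (hb : b ≠ 0) (hc : c ≠ 0) (hd : d ≠ 0)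
    (p : ℕ) (hp : p.Prime) (hp2 : p ≠ 2) (hndvd : ¬ ((p : ℤ) ∣ a * b * c * d))
    (l₁ l₂ l₃ l₄ : ℤ)
    (H : ∀ r₁ r₂ r₃ : ℂ,
      r₁ ^ 4 = (b : ℂ) / (a : ℂ) → r₂ ^ 4 = (c : ℂ) / (a : ℂ) →
      r₃ ^ 4 = (d : ℂ) / (a : ℂ) →
      ∀ x ∈ Subfield.closure ({Complex.I, r₁, r₂, r₃} : Set ℂ), x ^ 4 ≠ 2) :
    ∀ s₁ s₂ s₃ : ℂ,
      s₁ ^ 4 = (p : ℂ) ^ (l₂ - l₁) * ((b : ℂ) / (a : ℂ)) →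
      s₂ ^ 4 = (p : ℂ) ^ (l₃ - l₁) * ((c : ℂ) / (a : ℂ)) →
      s₃ ^ 4 = (p : ℂ) ^ (l₄ - l₁) * ((d : ℂ) / (a : ℂ)) →
      ∀ x ∈ Subfield.closure ({Complex.I, s₁, s₂, s₃} : Set ℂ), x ^ 4 ≠ 2 := by
  intro s₁ s₂ s₃ hs₁ hs₂ hs₃ x hx hx4
  have : Fact p.Prime := ⟨hp⟩
  obtain ⟨t, ht⟩ := IsAlgClosed.exists_pow_nat_eq (p : ℂ) (n := 4) (by norm_num)
  have hp0 : (p : ℂ) ≠ 0 := Nat.cast_ne_zero.2 hp.ne_zero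
  have ht0 : t ≠ 0 := by
    rintro rfl
    exact hp0 (by simpa using ht.symm)
  have hdiv : ∀ (s u : ℂ) (m : ℤ), s ^ 4 = (p : ℂ) ^ m * u → (s / t ^ m) ^ 4 = u := by
    intro s u m hs
    rw [div_pow, hs, ← ht, ← zpow_natCast (t ^ m), zpow_comm, zpow_natCast,
      mul_div_cancel_left₀ _ (zpow_ne_zero _ (pow_ne_zero _ ht0))]
  have hr₁ := hdiv _ _ _ hs₁
  have hr₂ := hdiv _ _ _ hs₂
  have hr₃ := hdiv _ _ _ hs₃
  have hx' : x ∈ Subfield.closure (insert t {s₃ / t ^ (l₄ - l₁), s₂ / t ^ (l₃ - l₁),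
      s₁ / t ^ (l₂ - l₁), Complex.I}) := by
    refine Subfield.closure_le.2 ?_ hx
    have hmem : ∀ (s : ℂ) (m : ℤ) (T : Set ℂ), s / t ^ m ∈ T →
        s ∈ Subfield.closure (insert t T) := by
      intro s m T h
      rw [← div_mul_cancel₀ s (zpow_ne_zero m ht0)]
      exact mul_mem (Subfield.subset_closure (Set.mem_insert_of_mem _ h))
        (zpow_mem (Subfield.subset_closure (Set.mem_insert _ _)) m)
    rintro y (rfl | rfl | rfl | rfl)
    · exact Subfield.subset_closure (by simp)
    · exact hmem _ (l₂ - l₁) _ (by simp)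
    · exact hmem _ (l₃ - l₁) _ (by simp)
    · exact hmem _ (l₄ - l₁) _ (by simp)
  have hH := H _ _ _ hr₁ hr₂ hr₃
  generalize s₁ / t ^ (l₂ - l₁) = r₁ at *
  generalize s₂ / t ^ (l₃ - l₁) = r₂ at *
  generalize s₃ / t ^ (l₄ - l₁) = r₃ at *
  have hrat : ∀ (T : Set ℂ) (z : ℂ) (q : ℚ), z = q → z ∈ Subfield.closure T := by
    rintro T _ q rfl
    exact SubfieldClass.ratCast_mem _ q
  have hI : ∀ T : Set ℂ, Complex.I ∈ T → Complex.I ∈ Subfield.closure T :=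
    fun T h => Subfield.subset_closure h
  have hndvd' : ¬ (p : ℤ) ∣ a ∧ ¬ (p : ℤ) ∣ b ∧ ¬ (p : ℤ) ∣ c ∧ ¬ (p : ℤ) ∣ d := by
    refine ⟨?_, ?_, ?_, ?_⟩ <;> intro h <;> apply hndvd
    · exact ((h.mul_right b).mul_right c).mul_right d
    · exact ((h.mul_left a).mul_right c).mul_right d
    · exact (h.mul_left (a * b)).mul_right d
    · exact h.mul_left (a * b * c)
  obtain ⟨hpa, hpb, hpc, hpd⟩ := hndvd'
  have hval : ∀ n : ℤ, ¬ (p : ℤ) ∣ n → padicValRat p n = 0 := by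
    intro n hn
    rw [padicValRat.of_int, padicValInt.eq_zero_of_not_dvd hn]
    rfl
  have hquot : ∀ n : ℤ, n ≠ 0 → ¬ (p : ℤ) ∣ n → ((n : ℚ) / a ≠ 0) ∧
      padicValRat p ((n : ℚ) / a) = 0 := by
    intro n hn hpn
    have hn' : (n : ℚ) ≠ 0 := by exact_mod_cast hn
    have ha' : (a : ℚ) ≠ 0 := by exact_mod_cast ha
    refine ⟨div_ne_zero hn' ha', ?_⟩
    rw [padicValRat.div hn' ha', hval n hpn, hval a hpa, sub_zero]
  obtain ⟨hB0, hB⟩ := hquot b hb hpb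
  obtain ⟨hC0, hC⟩ := hquot c hc hpc
  obtain ⟨hD0, hD⟩ := hquot d hd hpd
  replace hr₁ : r₁ ^ 4 = ((b / a : ℚ) : ℂ) := by rw [hr₁]; push_cast; rfl
  replace hr₂ : r₂ ^ 4 = ((c / a : ℚ) : ℂ) := by rw [hr₂]; push_cast; rfl
  replace hr₃ : r₃ ^ 4 = ((d / a : ℚ) : ℂ) := by rw [hr₃]; push_cast; rfl
  replace ht : t ^ 4 = ((p : ℚ) : ℂ) := by rw [ht]; push_cast; rfl
  generalize (b / a : ℚ) = B at *
  generalize (c / a : ℚ) = C at *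
  generalize (d / a : ℚ) = D at *
  have hP0 : (p : ℚ) ≠ 0 := by exact_mod_cast hp.ne_zero
  have hstep : ∀ (z y : ℂ) (j : ℕ) (q A : ℚ), A ≠ 0 → z ^ 4 = A → (z ^ j * y) ^ 4 = q →
      y ^ 4 = ((q / A ^ j : ℚ) : ℂ) := by
    intro z y j q A hA hz hq
    have hA' : (A : ℂ) ≠ 0 := by exact_mod_cast hA
    push_cast
    rw [eq_div_iff (pow_ne_zero _ hA'), ← hq, ← hz]
    ring
  have hvstep : ∀ (q A : ℚ) (j : ℕ), q ≠ 0 → A ≠ 0 →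
      q / A ^ j ≠ 0 ∧ padicValRat p (q / A ^ j) = padicValRat p q - j * padicValRat p A := by
    intro q A j hq hA
    refine ⟨div_ne_zero hq (pow_ne_zero _ hA), ?_⟩
    rw [padicValRat.div hq (pow_ne_zero _ hA), padicValRat.pow]
  have hx4' : x ^ 4 = ((2 : ℚ) : ℂ) := by rw [hx4]; norm_num
  obtain ⟨j, hj, y, hy, rfl⟩ := exists_eq_pow_mul_of_pow_four_mem (hI _ (by simp))
    (hrat _ _ _ ht) hx' (hrat _ _ _ hx4')
  have hy4 := hstep _ _ _ _ _ hP0 ht hx4'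
  obtain ⟨hq0, hv0⟩ := hvstep 2 p j two_ne_zero hP0
  have hy' := hy
  obtain ⟨e₃, -, y₃, hy₃, rfl⟩ := exists_eq_pow_mul_of_pow_four_mem (hI _ (by simp))
    (hrat _ _ _ hr₃) hy (hrat _ _ _ hy4)
  have hy₃4 := hstep _ _ _ _ _ hD0 hr₃ hy4
  obtain ⟨hq1, hv1⟩ := hvstep _ D e₃ hq0 hD0
  obtain ⟨e₂, -, y₂, hy₂, rfl⟩ := exists_eq_pow_mul_of_pow_four_mem (hI _ (by simp))
    (hrat _ _ _ hr₂) hy₃ (hrat _ _ _ hy₃4)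
  have hy₂4 := hstep _ _ _ _ _ hC0 hr₂ hy₃4
  obtain ⟨hq2, hv2⟩ := hvstep _ C e₂ hq1 hC0
  obtain ⟨e₁, -, y₁, hy₁, rfl⟩ := exists_eq_pow_mul_of_pow_four_mem (hI _ (by simp))
    (hrat _ _ _ hr₁) hy₂ (hrat _ _ _ hy₂4)
  have hy₁4 := hstep _ _ _ _ _ hB0 hr₁ hy₂4
  obtain ⟨hq3, hv3⟩ := hvstep _ B e₁ hq2 hB0
  have h4 := four_dvd_padicValRat_of_pow_four_eq hp2 hy₁ hy₁4
  have h2 : padicValRat p 2 = 0 := by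
    refine hval 2 fun h => hp2 ?_
    exact (Nat.prime_dvd_prime_iff_eq hp Nat.prime_two).1 (by exact_mod_cast h)
  have hPv : padicValRat p p = 1 := padicValRat.self hp.one_lt
  rw [hv3, hv2, hv1, hv0, hB, hC, hD, h2, hPv] at h4
  obtain rfl : j = 0 := by lia
  rw [pow_zero, one_mul] at hx4
  refine hH _ (Subfield.closure_mono ?_ hy') hx4
  rintro z (rfl | rfl | rfl | rfl) <;> simp
end

section
/- Let a, b, c, d be odd nonzero integers, and let r₁, r₂, r₃ ∈ ℂ satisfy r₁⁴ = b/a, r₂⁴ = c/a, r₃⁴ = d/a. Then no element x of the subfield of ℂ generated over ℚ by i, r₁, r₂, r₃ satisfies x⁴ = 2. -/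
open IntermediateField Polynomial in
/-- Kummer theory for one radical: over a field with a primitive `n`-th root of unity, an `n`-th
root lying in the extension generated by an `n`-th root `α` is a multiple of a power of `α`. -/
theorem exists_eq_algebraMap_mul_pow_of_adjoin_eq_top {K L : Type*} [Field K] [Field L]
    [Algebra K L] {n : ℕ} (hn : (n : K) ≠ 0) {ζ : K} (hζ : IsPrimitiveRoot ζ n) {α : L} {a : K}
    (hα : α ^ n = algebraMap K L a) (hα0 : α ≠ 0) (htop : K⟮α⟯ = ⊤)
    {x : L} {b : K} (hx : x ^ n = algebraMap K L b) :
    ∃ (k : K) (j : ℕ), x = algebraMap K L k * α ^ j := by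
  rcases eq_or_ne x 0 with rfl | hx0
  · exact ⟨0, 0, by simp⟩
  have hn0 : n ≠ 0 := by rintro rfl; simp at hn
  have : NeZero n := ⟨hn0⟩
  have hζL : IsPrimitiveRoot (algebraMap K L ζ) n := hζ.map_of_injective (algebraMap K L).injective
  have ha0 : a ≠ 0 := by
    rintro rfl
    exact pow_ne_zero n hα0 (by simpa using hα)
  have hsplit : (X ^ n - C a : K[X]).IsSplittingField K L := by
    rw [isSplittingField_iff_intermediateField]
    refine ⟨by simpa using X_pow_sub_C_splits_of_isPrimitiveRoot hζL hα, ?_⟩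
    rw [← top_le_iff, ← htop, adjoin_simple_le_iff]
    refine subset_adjoin _ _ ?_
    rw [mem_rootSet]
    exact ⟨X_pow_sub_C_ne_zero (Nat.pos_of_ne_zero hn0) a, by simp [hα]⟩
  have : FiniteDimensional K L := IsSplittingField.finiteDimensional L (X ^ n - C a)
  have : IsGalois K L := IsGalois.of_separable_splitting_field (separable_X_pow_sub_C a hn ha0)
  have hroot : ∀ {y : L} {c : K}, y ≠ 0 → y ^ n = algebraMap K L c → ∀ σ : Gal(L/K),
      ∃ i, σ y = algebraMap K L ζ ^ i * y := by
    intro y c hy0 hy σ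
    have h : (σ y / y) ^ n = 1 := by
      rw [div_pow, ← map_pow, hy, AlgEquiv.commutes, div_self]
      rw [← hy]
      exact pow_ne_zero n hy0
    obtain ⟨i, -, hi⟩ := hζL.eq_pow_of_pow_eq_one h
    exact ⟨i, by rw [hi, div_mul_cancel₀ _ hy0]⟩
  let f : Gal(L/K) →* L :=
    { toFun σ := σ α / α
      map_one' := by simp [hα0]
      map_mul' σ τ := by
        obtain ⟨i, hi⟩ := hroot hα0 hα σ
        obtain ⟨j, hj⟩ := hroot hα0 hα τ
        simp [hi, hj]
        field_simp }
  have hf : Function.Injective f := by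
    intro σ τ h
    have h' : σ α = τ α := (div_left_inj' hα0).1 h
    ext y
    have hy : y ∈ K⟮α⟯ := htop ▸ mem_top
    induction hy using adjoin_induction with
    | mem y hy => rwa [Set.mem_singleton_iff.1 hy]
    | algebraMap c => simp
    | add y z _ _ hy hz => rw [map_add, map_add, hy, hz]
    | inv y _ hy => rw [map_inv₀, map_inv₀, hy]
    | mul y z _ _ hy hz => rw [map_mul, map_mul, hy, hz]
  have : IsCyclic Gal(L/K) := isCyclic_of_injective_ringHom f hf
  obtain ⟨σ, hσ⟩ := IsCyclic.exists_generator (α := Gal(L/K))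
  obtain ⟨i, hi⟩ := hroot hx0 hx σ
  have hprim : IsPrimitiveRoot (f σ) (orderOf σ) := by
    rw [← orderOf_injective f hf σ]
    exact IsPrimitiveRoot.orderOf _
  have : NeZero (orderOf σ) := ⟨(orderOf_pos σ).ne'⟩
  have hpow : ∀ m : ℕ, (σ ^ m) x = (algebraMap K L ζ ^ i) ^ m * x := by
    intro m
    induction m with
    | zero => simp
    | succ m ih => rw [pow_succ', AlgEquiv.mul_apply, ih, map_mul, hi]; simp; ring
  have hone : (algebraMap K L ζ ^ i) ^ orderOf σ = 1 := by
    have := hpow (orderOf σ)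
    rw [pow_orderOf_eq_one, AlgEquiv.one_apply] at this
    exact (mul_eq_right₀ hx0).1 this.symm
  obtain ⟨j, -, hj⟩ := hprim.eq_pow_of_pow_eq_one hone
  have hfix : σ (x / α ^ j) = x / α ^ j := by
    have h1 : σ α = f σ * α := (div_mul_cancel₀ _ hα0).symm
    have h2 : f σ ≠ 0 := hprim.ne_zero (NeZero.ne _)
    rw [map_div₀, map_pow, hi, h1, ← hj, mul_pow, mul_div_mul_left _ _ (pow_ne_zero _ h2)]
  have hmem : x / α ^ j ∈ (⊥ : IntermediateField K L) := by
    rw [IsGalois.mem_bot_iff_fixed]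
    intro τ
    have hle : Subgroup.zpowers σ ≤ MulAction.stabilizer Gal(L/K) (x / α ^ j) := by
      rwa [Subgroup.zpowers_le, MulAction.mem_stabilizer_iff]
    exact hle (hσ τ)
  obtain ⟨k, hk⟩ := mem_bot.1 hmem
  exact ⟨k, j, by rw [hk, div_mul_cancel₀ _ (pow_ne_zero j hα0)]⟩

open IntermediateField in
/-- Kummer theory for one radical, in terms of subfields generated by sets. -/
theorem Subfield.exists_eq_mul_pow_of_mem_closure_insert {E : Type*} [Field E] {S : Set E} {n : ℕ}
    (hn : (n : E) ≠ 0) {ζ : E} (hζ : IsPrimitiveRoot ζ n) (hζS : ζ ∈ closure S) {α : E}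
    (hα : α ^ n ∈ closure S) (hα0 : α ≠ 0) {x : E} (hx : x ∈ closure (insert α S))
    (hxn : x ^ n ∈ closure S) :
    ∃ k ∈ closure S, ∃ j : ℕ, x = k * α ^ j := by
  let K := closure S
  have hle : closure (insert α S) ≤ K⟮α⟯.toSubfield := by
    rw [closure_le, Set.insert_subset_iff]
    exact ⟨mem_adjoin_simple_self K α, fun s hs => K⟮α⟯.algebraMap_mem ⟨s, subset_closure hs⟩⟩
  have hζK : IsPrimitiveRoot (⟨ζ, hζS⟩ : K) n :=
    IsPrimitiveRoot.of_map_of_injective (f := K.subtype) hζ K.subtype_injective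
  obtain ⟨k, j, h⟩ := exists_eq_algebraMap_mul_pow_of_adjoin_eq_top (K := K) (L := K⟮α⟯)
    (fun h => hn (by simpa using congrArg K.subtype h)) hζK
    (α := AdjoinSimple.gen K α) (a := ⟨α ^ n, hα⟩) (Subtype.ext rfl)
    (fun h => hα0 (congrArg Subtype.val h))
    (lift_injective _ (by rw [lift_adjoin_simple, lift_top, AdjoinSimple.coe_gen]))
    (x := ⟨x, hle hx⟩) (b := ⟨x ^ n, hxn⟩) (Subtype.ext rfl)
  exact ⟨k, k.2, j, congrArg Subtype.val h⟩

/-- Removing an adjoined fourth root of a rational `2`-adic unit preserves the `2`-adic valuation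
of a rational fourth power. -/
theorem exists_pow_four_eq_of_mem_closure_insert {S : Set ℂ}
    (hI : Complex.I ∈ Subfield.closure S) {α : ℂ} {u : ℚ} (hα : α ^ 4 = u) (hu0 : u ≠ 0)
    (hu : padicValRat 2 u = 0) {x : ℂ} (hx : x ∈ Subfield.closure (insert α S)) {q : ℚ}
    (hq0 : q ≠ 0) (hxq : x ^ 4 = q) :
    ∃ y ∈ Subfield.closure S, ∃ r : ℚ, r ≠ 0 ∧ padicValRat 2 r = padicValRat 2 q ∧ y ^ 4 = r := by
  have : Fact (Nat.Prime 2) := ⟨Nat.prime_two⟩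
  have hα0 : α ≠ 0 := by
    rintro rfl
    exact hu0 (by simpa using hα.symm)
  obtain ⟨k, hk, j, rfl⟩ := Subfield.exists_eq_mul_pow_of_mem_closure_insert (n := 4) (by norm_num)
    Complex.isPrimitiveRoot_I hI (hα ▸ SubfieldClass.ratCast_mem _ u) hα0 hx
    (hxq ▸ SubfieldClass.ratCast_mem _ q)
  refine ⟨k, hk, q / u ^ j, div_ne_zero hq0 (pow_ne_zero j hu0), ?_, ?_⟩
  · rw [padicValRat.div hq0 (pow_ne_zero j hu0), padicValRat.pow, hu]
    simp
  · push_cast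
    rw [← hxq, ← hα, eq_div_iff (pow_ne_zero _ (pow_ne_zero _ hα0))]
    ring

theorem exists_rat_normSq_eq_of_mem_closure_I {z : ℂ}
    (hz : z ∈ Subfield.closure ({Complex.I} : Set ℂ)) : ∃ q : ℚ, Complex.normSq z = q := by
  suffices h : ∃ a b : ℚ, z = a + b * Complex.I by
    obtain ⟨a, b, rfl⟩ := h
    exact ⟨a ^ 2 + b ^ 2, by simp [Complex.normSq_apply]; ring⟩
  induction hz using Subfield.closure_induction with
  | mem x hx => exact ⟨0, 1, by simpa using hx⟩
  | one => exact ⟨1, 0, by simp⟩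
  | add x y _ _ hx hy =>
    obtain ⟨a, b, rfl⟩ := hx
    obtain ⟨c, d, rfl⟩ := hy
    exact ⟨a + c, b + d, by push_cast; ring⟩
  | neg x _ hx =>
    obtain ⟨a, b, rfl⟩ := hx
    exact ⟨-a, -b, by push_cast; ring⟩
  | inv x _ hx =>
    obtain ⟨a, b, rfl⟩ := hx
    refine ⟨a / (a ^ 2 + b ^ 2), -b / (a ^ 2 + b ^ 2), ?_⟩
    rw [Complex.inv_def]
    simp [Complex.normSq_apply]
    ring
  | mul x y _ _ hx hy =>
    obtain ⟨a, b, rfl⟩ := hx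
    obtain ⟨c, d, rfl⟩ := hy
    exact ⟨a * c - b * d, a * d + b * c, by
      push_cast; linear_combination (b * d : ℂ) * Complex.I_sq⟩

theorem even_padicValRat_two_of_pow_four_eq {z : ℂ}
    (hz : z ∈ Subfield.closure ({Complex.I} : Set ℂ)) {q : ℚ} (hzq : z ^ 4 = q) :
    Even (padicValRat 2 q) := by
  have : Fact (Nat.Prime 2) := ⟨Nat.prime_two⟩
  obtain ⟨s, hs⟩ := exists_rat_normSq_eq_of_mem_closure_I hz
  have h : s ^ 4 = q ^ 2 := by
    have := congrArg Complex.normSq hzq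
    rw [map_pow, hs, Complex.normSq_ratCast, ← sq] at this
    exact_mod_cast this
  have hv := congrArg (padicValRat 2) h
  rw [padicValRat.pow, padicValRat.pow] at hv
  push_cast at hv
  exact ⟨padicValRat 2 s, by omega⟩

theorem padicValRat_two_eq_zero_of_odd {m : ℤ} (hm : Odd m) : padicValRat 2 (m : ℚ) = 0 := by
  rw [padicValRat.of_int, Nat.cast_eq_zero]
  exact padicValInt.eq_zero_of_not_dvd (by exact_mod_cast Int.two_dvd_ne_zero.2 (Int.odd_iff.1 hm))

/-- Lemma 5.9 part 5: for odd nonzero integers `a, b, c, d`, the field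
`ℚ(i, (b/a)^{1/4}, (c/a)^{1/4}, (d/a)^{1/4}) ⊆ ℂ` contains no fourth root of `2`. -/
theorem stmt6 (a b c d : ℤ) (ha : Odd a) (hb : Odd b) (hc : Odd c) (hd : Odd d)
    (ha0 : a ≠ 0) (hb0 : b ≠ 0) (hc0 : c ≠ 0) (hd0 : d ≠ 0)
    (r₁ r₂ r₃ : ℂ) (h₁ : r₁ ^ 4 = (b : ℂ) / (a : ℂ)) (h₂ : r₂ ^ 4 = (c : ℂ) / (a : ℂ))
    (h₃ : r₃ ^ 4 = (d : ℂ) / (a : ℂ)) :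
    ∀ x ∈ Subfield.closure ({Complex.I, r₁, r₂, r₃} : Set ℂ), x ^ 4 ≠ 2 := by
  have : Fact (Nat.Prime 2) := ⟨Nat.prime_two⟩
  have ha' : (a : ℚ) ≠ 0 := by exact_mod_cast ha0
  have hunit : ∀ m : ℤ, Odd m → m ≠ 0 → (m / a : ℚ) ≠ 0 ∧ padicValRat 2 (m / a : ℚ) = 0 := by
    intro m hm hm0
    have hm' : (m : ℚ) ≠ 0 := by exact_mod_cast hm0
    refine ⟨div_ne_zero hm' ha', ?_⟩
    rw [padicValRat.div hm' ha', padicValRat_two_eq_zero_of_odd hm,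
      padicValRat_two_eq_zero_of_odd ha, sub_zero]
  intro x hx hx2
  have hperm : ({Complex.I, r₁, r₂, r₃} : Set ℂ) = {r₃, r₂, r₁, Complex.I} := by
    ext
    simp only [Set.mem_insert_iff, Set.mem_singleton_iff]
    tauto
  rw [hperm] at hx
  obtain ⟨x₃, hx₃, q₃, hq₃, hv₃, he₃⟩ := exists_pow_four_eq_of_mem_closure_insert
    (Subfield.subset_closure (by simp)) (u := d / a) (by push_cast; exact h₃)
    (hunit d hd hd0).1 (hunit d hd hd0).2 hx (q := 2) two_ne_zero (by exact_mod_cast hx2)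
  obtain ⟨x₂, hx₂, q₂, hq₂, hv₂, he₂⟩ := exists_pow_four_eq_of_mem_closure_insert
    (Subfield.subset_closure (by simp)) (u := c / a) (by push_cast; exact h₂)
    (hunit c hc hc0).1 (hunit c hc hc0).2 hx₃ hq₃ he₃
  obtain ⟨x₁, hx₁, q₁, hq₁, hv₁, he₁⟩ := exists_pow_four_eq_of_mem_closure_insert
    (Subfield.subset_closure (by simp)) (u := b / a) (by push_cast; exact h₁)
    (hunit b hb hb0).1 (hunit b hb hb0).2 hx₂ hq₂ he₂
  have heven := even_padicValRat_two_of_pow_four_eq hx₁ he₁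
  have htwo : padicValRat 2 (2 : ℚ) = 1 := by
    exact_mod_cast padicValRat.self (p := 2) one_lt_two
  rw [hv₁, hv₂, hv₃, htwo] at heven
  exact Int.not_even_one heven
end

section
/- Let a and b be odd integers, each fourth-power-free (no fourth power of a prime divides them) and each different from 1 and −1. Let r₁, r₂ ∈ ℂ satisfy r₁⁴ = 2a and r₂⁴ = 2b, and let F be the subfield of ℂ generated over ℚ by i, r₁, r₂. Then some x ∈ F satisfies x⁴ = 2 if and only if, after possibly interchanging a and b, the following holds for every odd prime p: if p divides b, then p divides b exactly to the power 2 and the exponent of p in a is 1 or 3; and if p does not divide b, then the exponent of p in a is 0 or 2. -/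
open IntermediateField Polynomial in
theorem exists_mul_pow_mem_range_of_mem_adjoin {K E : Type*} [Field K] [Field E] [Algebra K E]
    {n : ℕ} [NeZero n] {ζ : K} (hζ : IsPrimitiveRoot ζ n) {r y : E}
    (hr : r ^ n ∈ Set.range (algebraMap K E)) (hy : y ^ n ∈ Set.range (algebraMap K E))
    (hyr : y ∈ K⟮r⟯) : ∃ m : ℕ, y * r ^ m ∈ Set.range (algebraMap K E) := by
  obtain ⟨c, hc⟩ := hr
  obtain ⟨d, hd⟩ := hy
  rcases eq_or_ne y 0 with rfl | hy0
  · exact ⟨0, 0, by simp⟩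
  rcases eq_or_ne r 0 with rfl | hr0
  · rw [adjoin_zero] at hyr
    exact ⟨0, by simpa [mem_bot] using hyr⟩
  have hc0 : c ≠ 0 := by
    rintro rfl
    exact pow_ne_zero n hr0 (by rw [← hc, map_zero])
  have hint : IsIntegral K r := .of_pow (NeZero.pos n) (hc ▸ isIntegral_algebraMap)
  let s : K⟮r⟯ := AdjoinSimple.gen K r
  have hs : s ^ n = algebraMap K K⟮r⟯ c := Subtype.ext (by simpa [s] using hc.symm)
  let u : K⟮r⟯ := ⟨y, hyr⟩
  have hu : u ^ n = algebraMap K K⟮r⟯ d := Subtype.ext (by simpa [u] using hd.symm)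
  have hs0 : s ≠ 0 := fun h => hr0 (by simpa [s] using congrArg Subtype.val h)
  have hu0 : u ≠ 0 := fun h => hy0 (congrArg Subtype.val h)
  have hζ' := hζ.map_of_injective (algebraMap K K⟮r⟯).injective
  have : FiniteDimensional K K⟮r⟯ := adjoin.finiteDimensional hint
  have : (X ^ n - C c).IsSplittingField K K⟮r⟯ := by
    refine ⟨?_, ?_⟩
    · simpa using X_pow_sub_C_splits_of_isPrimitiveRoot hζ' hs
    · rw [eq_top_iff, ← (adjoin.powerBasis hint).adjoin_gen_eq_top]
      refine Algebra.adjoin_mono ?_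
      rw [Set.singleton_subset_iff, mem_rootSet]
      refine ⟨X_pow_sub_C_ne_zero (NeZero.pos n) c, ?_⟩
      change aeval s _ = 0
      simp [hs]
  have hnK : (n : K) ≠ 0 := hζ.neZero'.out
  have : IsGalois K K⟮r⟯ := .of_separable_splitting_field (separable_X_pow_sub_C c hnK hc0)
  have key (t : K⟮r⟯) (ht0 : t ≠ 0) (e : K) (ht : t ^ n = algebraMap K K⟮r⟯ e)
      (σ : Gal(K⟮r⟯/K)) : ∃ ω : K, ω ^ n = 1 ∧ σ t = ω • t := by
    have h1 : (σ t / t) ^ n = 1 := by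
      rw [div_pow, ← map_pow, ht, AlgEquiv.commutes, ← ht, div_self (pow_ne_zero _ ht0)]
    obtain ⟨i, -, hi⟩ := hζ'.eq_pow_of_pow_eq_one h1
    refine ⟨ζ ^ i, ?_, ?_⟩
    · rw [← pow_mul, mul_comm, pow_mul, hζ.pow_eq_one, one_pow]
    · rw [Algebra.smul_def, map_pow, hi, div_mul_cancel₀ _ ht0]
  let B := adjoin.powerBasis hint
  obtain ⟨j, hj⟩ : ∃ j, B.basis.repr u j ≠ 0 := by
    by_contra! h
    exact hu0 (B.basis.repr.map_eq_zero_iff.mp (Finsupp.ext h))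
  have hsum : ∑ i, B.basis.repr u i • s ^ (i : ℕ) = u := by
    conv_rhs => rw [← B.basis.sum_repr u]
    simp only [B.basis_eq_pow]
    rfl
  have hfix : u * s ^ ((n - 1) * j) ∈ Set.range (algebraMap K K⟮r⟯) := by
    rw [IsGalois.mem_range_algebraMap_iff_fixed]
    intro σ
    obtain ⟨ω, hω, hωs⟩ := key s hs0 c hs σ
    obtain ⟨η, -, hηu⟩ := key u hu0 d hu σ
    have h1 : ∑ i, (B.basis.repr u i * ω ^ (i : ℕ)) • B.basis i = η • u := by
      rw [← hηu]
      conv_rhs => rw [← hsum, map_sum]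
      refine Finset.sum_congr rfl fun i _ => ?_
      rw [map_smul, map_pow, hωs, _root_.smul_pow, mul_smul, B.basis_eq_pow]
      rfl
    have h2 : B.basis.repr u j * ω ^ (j : ℕ) = η * B.basis.repr u j := by
      have := congrArg (fun x => B.basis.repr x j) h1
      simpa only [B.basis.repr_sum_self, map_smul, Finsupp.smul_apply, smul_eq_mul] using this
    have h3 : η = ω ^ (j : ℕ) := mul_right_cancel₀ hj (by rw [← h2, mul_comm])
    rw [map_mul, map_pow, hηu, hωs, h3, _root_.smul_pow, smul_mul_smul_comm, ← pow_add]
    have : (j : ℕ) + (n - 1) * j = n * j := by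
      obtain ⟨k, hk⟩ := Nat.exists_eq_succ_of_ne_zero (NeZero.ne n)
      rw [hk, Nat.succ_sub_one, Nat.succ_mul, add_comm]
    rw [this, pow_mul, hω, one_pow, one_smul]
  obtain ⟨e, he⟩ := hfix
  exact ⟨(n - 1) * j, e, by simpa [u, s] using congrArg Subtype.val he⟩

theorem Complex.exists_mul_pow_mem_closure {S : Set ℂ} (hI : Complex.I ∈ S) {r y : ℂ}
    (hr : r ^ 4 ∈ Subfield.closure S) (hy : y ^ 4 ∈ Subfield.closure S)
    (hyr : y ∈ Subfield.closure (insert r S)) : ∃ m : ℕ, y * r ^ m ∈ Subfield.closure S := by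
  let K := Subfield.closure S
  have hζ : IsPrimitiveRoot (⟨Complex.I, Subfield.subset_closure hI⟩ : K) 4 :=
    IsPrimitiveRoot.of_map_of_injective (f := K.subtype) (by exact Complex.isPrimitiveRoot_I)
      K.subtype.injective
  have hle : Subfield.closure (insert r S) ≤ (IntermediateField.adjoin K {r}).toSubfield := by
    rw [Subfield.closure_le, Set.insert_subset_iff]
    refine ⟨IntermediateField.mem_adjoin_simple_self K r, fun s hs => ?_⟩
    exact (IntermediateField.adjoin K {r}).algebraMap_mem ⟨s, Subfield.subset_closure hs⟩
  obtain ⟨m, k, hk⟩ := exists_mul_pow_mem_range_of_mem_adjoin hζ (r := r) (y := y)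
    ⟨⟨_, hr⟩, rfl⟩ ⟨⟨_, hy⟩, rfl⟩ (hle hyr)
  exact ⟨m, hk ▸ k.2⟩

theorem Complex.exists_rat_of_mem_closure_I {z : ℂ} (hz : z ∈ Subfield.closure {Complex.I}) :
    ∃ u v : ℚ, z = u + v * Complex.I := by
  induction hz using Subfield.closure_induction with
  | mem x hx => exact ⟨0, 1, by simpa using hx⟩
  | one => exact ⟨1, 0, by simp⟩
  | add x y _ _ hx hy =>
    obtain ⟨u, v, rfl⟩ := hx
    obtain ⟨s, t, rfl⟩ := hy
    exact ⟨u + s, v + t, by push_cast; ring⟩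
  | neg x _ hx =>
    obtain ⟨u, v, rfl⟩ := hx
    exact ⟨-u, -v, by push_cast; ring⟩
  | inv x _ hx =>
    obtain ⟨u, v, rfl⟩ := hx
    rcases eq_or_ne (u ^ 2 + v ^ 2) 0 with h0 | h0
    · obtain rfl : u = 0 := by nlinarith [sq_nonneg u, sq_nonneg v]
      obtain rfl : v = 0 := by nlinarith [sq_nonneg v]
      exact ⟨0, 0, by simp⟩
    · refine ⟨u / (u ^ 2 + v ^ 2), -v / (u ^ 2 + v ^ 2), inv_eq_of_mul_eq_one_right ?_⟩
      have h0' : (u ^ 2 + v ^ 2 : ℂ) ≠ 0 := by exact_mod_cast h0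
      push_cast
      field_simp
      linear_combination -(v ^ 2 : ℂ) * Complex.I_sq
  | mul x y _ _ hx hy =>
    obtain ⟨u, v, rfl⟩ := hx
    obtain ⟨s, t, rfl⟩ := hy
    refine ⟨u * s - v * t, u * t + v * s, ?_⟩
    push_cast
    linear_combination (v * t : ℂ) * Complex.I_sq

theorem Complex.eq_pow_four_or_of_mem_closure_I {z : ℂ}
    (hz : z ∈ Subfield.closure {Complex.I}) {c : ℚ} (hc : z ^ 4 = c) :
    ∃ w : ℚ, c = w ^ 4 ∨ c = -4 * w ^ 4 := by
  obtain ⟨u, v, rfl⟩ := Complex.exists_rat_of_mem_closure_I hz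
  have h : ((u ^ 4 - 6 * u ^ 2 * v ^ 2 + v ^ 4 - c : ℚ) : ℂ) +
      ((4 * (u * v * (u - v) * (u + v)) : ℚ) : ℂ) * Complex.I = 0 := by
    push_cast
    linear_combination hc - (6 * u ^ 2 * v ^ 2 + 4 * u * v ^ 3 * I + v ^ 4 * (I ^ 2 - 1)) * I_sq
  have hre := congrArg Complex.re h
  have him := congrArg Complex.im h
  simp only [Complex.add_re, Complex.add_im, Complex.mul_re, Complex.mul_im, Complex.ratCast_re,
    Complex.ratCast_im, Complex.I_re, Complex.I_im, Complex.zero_re, Complex.zero_im, mul_zero,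
    mul_one, sub_zero, add_zero, zero_add] at hre him
  norm_cast at hre him
  rcases (by simpa using him : ((u = 0 ∨ v = 0) ∨ u - v = 0) ∨ u + v = 0) with
    ((rfl | rfl) | h) | h
  · exact ⟨v, .inl (by linarith)⟩
  · exact ⟨u, .inl (by linarith)⟩
  · obtain rfl : u = v := by linarith
    exact ⟨u, .inr (by linarith)⟩
  · obtain rfl : u = -v := by linarith
    exact ⟨v, .inr (by linarith)⟩

theorem padicValRat_intCast_eq_factorization (p : ℕ) [hp : Fact p.Prime] (a : ℤ) :
    padicValRat p (a : ℚ) = a.natAbs.factorization p := by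
  rw [padicValRat.of_int, padicValInt, Nat.factorization_def _ hp.out]

theorem Int.factorization_natAbs_two_of_odd {a : ℤ} (ha : Odd a) :
    a.natAbs.factorization 2 = 0 :=
  Nat.factorization_eq_zero_of_not_dvd (Int.natAbs_odd.mpr ha).not_two_dvd_nat

theorem Int.factorization_natAbs_lt_of_not_pow_dvd {a : ℤ} (ha0 : a ≠ 0) {p k : ℕ}
    (hp : p.Prime) (ha : ¬ (p : ℤ) ^ k ∣ a) : a.natAbs.factorization p < k := by
  contrapose! ha
  have := (hp.pow_dvd_iff_le_factorization (Int.natAbs_ne_zero.mpr ha0)).mpr ha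
  rw [← Int.natCast_pow]
  exact Int.natCast_dvd.mpr this

theorem odd_add_and_four_dvd_of_eq_pow_four {a b : ℤ} (ha : Odd a) (hb : Odd b) {m n : ℕ} {w : ℚ}
    (h : (2 * (2 * a) ^ m * (2 * b) ^ n : ℚ) = w ^ 4 ∨
      (2 * (2 * a) ^ m * (2 * b) ^ n : ℚ) = -4 * w ^ 4) :
    Odd (m + n) ∧ ∀ p : ℕ, p.Prime → p ≠ 2 →
      4 ∣ m * a.natAbs.factorization p + n * b.natAbs.factorization p := by
  have ha0 : (a : ℚ) ≠ 0 := by rintro h; norm_cast at h; subst h; simp at ha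
  have hb0 : (b : ℚ) ≠ 0 := by rintro h; norm_cast at h; subst h; simp at hb
  have h2 : (2 : ℚ) ≠ 0 := two_ne_zero
  have hw : w ≠ 0 := by
    rintro rfl
    have : (2 * (2 * a) ^ m * (2 * b) ^ n : ℚ) ≠ 0 := by positivity
    simp at h
    grind
  have hval (p : ℕ) [Fact p.Prime] :
      ((1 + m + n) * padicValRat p 2 + m * a.natAbs.factorization p
        + n * b.natAbs.factorization p = 4 * padicValRat p w) ∨
      ((1 + m + n) * padicValRat p 2 + m * a.natAbs.factorization p
        + n * b.natAbs.factorization p = 2 * padicValRat p 2 + 4 * padicValRat p w) := by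
    rw [← padicValRat_intCast_eq_factorization, ← padicValRat_intCast_eq_factorization]
    have hl : padicValRat p (2 * (2 * a) ^ m * (2 * b) ^ n : ℚ) =
        (1 + m + n) * padicValRat p 2 + m * padicValRat p a + n * padicValRat p b := by
      rw [padicValRat.mul (by positivity) (by positivity), padicValRat.mul h2 (by positivity),
        padicValRat.pow, padicValRat.pow, padicValRat.mul h2 ha0, padicValRat.mul h2 hb0]
      ring
    rw [← hl]
    refine h.imp (fun h => ?_) (fun h => ?_)
    · rw [h, padicValRat.pow]
      rfl
    · rw [h, show (-4 * w ^ 4 : ℚ) = -(2 ^ 2 * w ^ 4) by ring, padicValRat.neg,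
        padicValRat.mul (by positivity) (by positivity), padicValRat.pow, padicValRat.pow]
      rfl
  constructor
  · have := hval 2
    have h22 : padicValRat 2 2 = 1 := by exact_mod_cast padicValRat.self (p := 2) one_lt_two
    rw [h22, Int.factorization_natAbs_two_of_odd ha, Int.factorization_natAbs_two_of_odd hb] at this
    rw [Nat.odd_iff]
    push_cast at this
    omega
  · intro p hp hp2
    have := Fact.mk hp
    have hp0 : padicValRat p 2 = 0 := by
      have h0 : padicValNat p 2 = 0 := padicValNat.eq_zero_of_not_dvd fun h =>
        hp2 ((Nat.prime_dvd_prime_iff_eq hp Nat.prime_two).mp h)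
      rw [← Nat.cast_ofNat, padicValRat.of_nat, h0, Nat.cast_zero]
    have := hval p
    rw [hp0] at this
    zify
    omega

theorem Int.natAbs_eq_one_of_factorization_eq_zero {a : ℤ} (ha : Odd a)
    (h : ∀ p : ℕ, p.Prime → p ≠ 2 → a.natAbs.factorization p = 0) : a.natAbs = 1 := by
  refine Nat.eq_of_factorization_eq (Int.natAbs_ne_zero.mpr ?_) one_ne_zero fun p => ?_
  · rintro rfl
    simp at ha
  · rw [Nat.factorization_one, Finsupp.zero_apply]
    by_cases hp : p.Prime
    · rcases eq_or_ne p 2 with rfl | hp2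
      · exact Int.factorization_natAbs_two_of_odd ha
      · exact h p hp hp2
    · exact Nat.factorization_eq_zero_of_not_prime _ hp

theorem Int.factorization_of_four_dvd {a b : ℤ} (ha : Odd a) (hb : Odd b)
    (ha4 : ∀ p : ℕ, p.Prime → ¬ ((p : ℤ) ^ 4 ∣ a))
    (hb4 : ∀ p : ℕ, p.Prime → ¬ ((p : ℤ) ^ 4 ∣ b))
    (ha1 : a ≠ 1) (ha1' : a ≠ -1) {m n : ℕ} (hm : Odd m) (hn : Even n)
    (h : ∀ p : ℕ, p.Prime → p ≠ 2 →
      4 ∣ m * a.natAbs.factorization p + n * b.natAbs.factorization p)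
    {p : ℕ} (hp : p.Prime) (hp2 : p ≠ 2) :
    ((p : ℤ) ∣ a → a.natAbs.factorization p = 2 ∧
        (b.natAbs.factorization p = 1 ∨ b.natAbs.factorization p = 3)) ∧
      (¬ (p : ℤ) ∣ a → b.natAbs.factorization p = 0 ∨ b.natAbs.factorization p = 2) := by
  have ha0 : a ≠ 0 := by rintro rfl; simp at ha
  have hb0 : b ≠ 0 := by rintro rfl; simp at hb
  rw [Nat.odd_iff] at hm
  rw [Nat.even_iff] at hn
  have hn4 : n % 4 = 2 := by
    by_contra hn4
    have : a.natAbs = 1 := by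
      refine Int.natAbs_eq_one_of_factorization_eq_zero ha fun q hq hq2 => ?_
      have hlt := Int.factorization_natAbs_lt_of_not_pow_dvd ha0 hq (ha4 q hq)
      have hdvd := h q hq hq2
      rw [Nat.dvd_add_left (Dvd.dvd.mul_right (by omega) _)] at hdvd
      generalize a.natAbs.factorization q = x at *
      interval_cases x <;> omega
    omega
  have hva := Int.factorization_natAbs_lt_of_not_pow_dvd ha0 hp (ha4 p hp)
  have hvb := Int.factorization_natAbs_lt_of_not_pow_dvd hb0 hp (hb4 p hp)
  have hdvd := h p hp hp2
  have hpa : (p : ℤ) ∣ a ↔ 1 ≤ a.natAbs.factorization p := by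
    rw [Int.natCast_dvd, hp.dvd_iff_one_le_factorization (Int.natAbs_ne_zero.mpr ha0)]
  rw [hpa]
  generalize a.natAbs.factorization p = x at *
  generalize b.natAbs.factorization p = y at *
  interval_cases x <;> interval_cases y <;> omega

theorem Nat.exists_eq_pow_of_dvd_factorization {k a : ℕ} (hk : k ≠ 0) (ha : a ≠ 0)
    (h : ∀ p : ℕ, p.Prime → k ∣ a.factorization p) : ∃ t, a = t ^ k := by
  refine ⟨Nat.floorRoot k a, Nat.eq_of_factorization_eq ha ?_ fun p => ?_⟩
  · exact pow_ne_zero _ (Nat.floorRoot_ne_zero.mpr ⟨hk, ha⟩)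
  · rw [Nat.factorization_pow, Nat.factorization_floorRoot, Finsupp.smul_apply,
      Finsupp.floorDiv_apply, Nat.floorDiv_eq_div, smul_eq_mul]
    by_cases hp : p.Prime
    · rw [Nat.mul_div_cancel' (h p hp)]
    · simp [Nat.factorization_eq_zero_of_not_prime _ hp]

theorem Subfield.exists_pow_four_eq_two {F : Subfield ℂ} {a b : ℤ} (ha : Odd a) (hb : Odd b)
    {r s : ℂ} (hI : Complex.I ∈ F) (hr : r ∈ F) (hs : s ∈ F)
    (hra : r ^ 4 = 2 * (a : ℂ)) (hsb : s ^ 4 = 2 * (b : ℂ))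
    (h : ∀ p : ℕ, p.Prime → p ≠ 2 →
      (((p : ℤ) ∣ b → b.natAbs.factorization p = 2 ∧
          (a.natAbs.factorization p = 1 ∨ a.natAbs.factorization p = 3)) ∧
       (¬ (p : ℤ) ∣ b →
          a.natAbs.factorization p = 0 ∨ a.natAbs.factorization p = 2))) :
    ∃ x ∈ F, x ^ 4 = 2 := by
  have ha0 : a ≠ 0 := by rintro rfl; simp at ha
  have hb0 : b ≠ 0 := by rintro rfl; simp at hb
  have ha0' := Int.natAbs_ne_zero.mpr ha0
  have hb0' := Int.natAbs_ne_zero.mpr hb0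
  have hroot (k : ℕ) (hk : Odd k) : ∃ t, a.natAbs ^ 2 * b.natAbs ^ k = t ^ 4 := by
    refine Nat.exists_eq_pow_of_dvd_factorization four_ne_zero
      (mul_ne_zero (pow_ne_zero _ ha0') (pow_ne_zero _ hb0')) fun p hp => ?_
    rw [Nat.factorization_mul (pow_ne_zero _ ha0') (pow_ne_zero _ hb0'), Nat.factorization_pow,
      Nat.factorization_pow]
    simp only [Finsupp.add_apply, Finsupp.smul_apply, smul_eq_mul]
    rcases eq_or_ne p 2 with rfl | hp2
    · simp [Int.factorization_natAbs_two_of_odd ha, Int.factorization_natAbs_two_of_odd hb]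
    · obtain ⟨h1, h2⟩ := h p hp hp2
      obtain ⟨l, rfl⟩ := hk
      by_cases hpb : (p : ℤ) ∣ b
      · obtain ⟨h3, h4⟩ := h1 hpb
        rw [h3]
        omega
      · rw [Nat.factorization_eq_zero_of_not_dvd (fun h => hpb (Int.natCast_dvd.mpr h)), mul_zero]
        have := h2 hpb
        omega
  have hbC : (b : ℂ) ≠ 0 := by exact_mod_cast hb0
  have haC : (a : ℂ) ≠ 0 := by exact_mod_cast ha0
  rcases le_total 0 b with hpos | hneg
  · obtain ⟨t, ht⟩ := hroot 3 (by decide)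
    have htC : (a ^ 2 * b ^ 3 : ℂ) = t ^ 4 := by
      have : (a ^ 2 * b ^ 3 : ℤ) = t ^ 4 := by
        zify at ht
        rwa [sq_abs, abs_of_nonneg hpos] at ht
      exact_mod_cast this
    refine ⟨r ^ 2 / s * b / t, div_mem (mul_mem (div_mem (pow_mem hr 2) hs)
      (intCast_mem F b)) (natCast_mem F t), ?_⟩
    rw [div_pow, mul_pow, div_pow, ← pow_mul, mul_comm 2 4, pow_mul, hra, hsb, ← htC]
    field_simp
  · obtain ⟨t, ht⟩ := hroot 1 (by decide)
    have htC : (a ^ 2 * -b : ℂ) = t ^ 4 := by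
      have : (a ^ 2 * -b : ℤ) = t ^ 4 := by
        zify at ht
        rwa [sq_abs, pow_one, abs_of_nonpos hneg] at ht
      exact_mod_cast this
    refine ⟨r ^ 2 * s / ((1 + Complex.I) * t), div_mem (mul_mem (pow_mem hr 2) hs)
      (mul_mem (add_mem (one_mem F) hI) (natCast_mem F t)), ?_⟩
    have hI4 : (1 + Complex.I) ^ 4 = -4 := by
      linear_combination (Complex.I ^ 2 + 4 * Complex.I + 5) * Complex.I_sq
    rw [div_pow, mul_pow, mul_pow, ← pow_mul, mul_comm 2 4, pow_mul, hra, hsb, ← htC, hI4]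
    field_simp
    norm_num


/-- Lemma 5.9 part 6: for odd, fourth-power-free integers `a, b ∉ {1, -1}`, the field
`ℚ(i, (2a)^{1/4}, (2b)^{1/4}) ⊆ ℂ` contains a fourth root of `2` iff (after possibly
interchanging `a` and `b`) for every odd prime `p`: if `p ∣ b` then `p` divides `b`
exactly to the power `2` and the exponent of `p` in `a` is `1` or `3`, and if
`p ∤ b` then the exponent of `p` in `a` is `0` or `2`. -/
theorem stmt7 (a b : ℤ) (ha : Odd a) (hb : Odd b)
    (ha4 : ∀ p : ℕ, p.Prime → ¬ ((p : ℤ) ^ 4 ∣ a))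
    (hb4 : ∀ p : ℕ, p.Prime → ¬ ((p : ℤ) ^ 4 ∣ b))
    (ha1 : a ≠ 1) (ha1' : a ≠ -1) (hb1 : b ≠ 1) (hb1' : b ≠ -1)
    (r₁ r₂ : ℂ) (h₁ : r₁ ^ 4 = 2 * (a : ℂ)) (h₂ : r₂ ^ 4 = 2 * (b : ℂ)) :
    (∃ x ∈ Subfield.closure ({Complex.I, r₁, r₂} : Set ℂ), x ^ 4 = 2) ↔
      ∃ a' b' : ℤ, ((a', b') = (a, b) ∨ (a', b') = (b, a)) ∧
        ∀ p : ℕ, p.Prime → p ≠ 2 →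
          (((p : ℤ) ∣ b' → b'.natAbs.factorization p = 2 ∧
              (a'.natAbs.factorization p = 1 ∨ a'.natAbs.factorization p = 3)) ∧
           (¬ (p : ℤ) ∣ b' →
              a'.natAbs.factorization p = 0 ∨ a'.natAbs.factorization p = 2)) := by
  constructor
  · rintro ⟨x, hx, hx4⟩
    have hint (S : Set ℂ) (c : ℤ) : 2 * (c : ℂ) ∈ Subfield.closure S :=
      mul_mem (ofNat_mem _ 2) (intCast_mem _ c)
    obtain ⟨n, hn⟩ := Complex.exists_mul_pow_mem_closure (S := {r₁, Complex.I}) (r := r₂) (y := x)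
      (by simp) (h₂ ▸ hint _ b) (hx4 ▸ ofNat_mem _ 2)
      (Subfield.closure_mono (by intro z; simp; tauto) hx)
    have hn4 : (x * r₂ ^ n) ^ 4 = 2 * (2 * b) ^ n := by
      rw [mul_pow, hx4, ← pow_mul, mul_comm n, pow_mul, h₂]
    obtain ⟨m, hm⟩ := Complex.exists_mul_pow_mem_closure (S := {Complex.I}) (r := r₁) (by simp)
      (h₁ ▸ hint _ a) (hn4 ▸ mul_mem (ofNat_mem _ 2) (pow_mem (hint _ b) n)) hn
    have hm4 : (x * r₂ ^ n * r₁ ^ m) ^ 4 = ((2 * (2 * a) ^ m * (2 * b) ^ n : ℚ) : ℂ) := by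
      rw [mul_pow, hn4, ← pow_mul, mul_comm m, pow_mul, h₁]
      push_cast
      ring
    obtain ⟨w, hw⟩ := Complex.eq_pow_four_or_of_mem_closure_I hm hm4
    obtain ⟨hodd, hdvd⟩ := odd_add_and_four_dvd_of_eq_pow_four ha hb hw
    rcases Nat.even_or_odd n with hn2 | hn2
    · exact ⟨b, a, .inr rfl, fun p hp hp2 => Int.factorization_of_four_dvd ha hb ha4 hb4 ha1 ha1'
        (by grind) hn2 hdvd hp hp2⟩
    · exact ⟨a, b, .inl rfl, fun p hp hp2 => Int.factorization_of_four_dvd hb ha hb4 ha4 hb1 hb1'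
        hn2 (by grind) (fun q hq hq2 => add_comm (m * _) _ ▸ hdvd q hq hq2) hp hp2⟩
  · rintro ⟨a', b', h | h, hab⟩
    · obtain ⟨rfl, rfl⟩ := Prod.mk.inj h
      exact Subfield.exists_pow_four_eq_two ha hb (Subfield.subset_closure (by simp))
        (Subfield.subset_closure (by simp)) (Subfield.subset_closure (by simp)) h₁ h₂ hab
    · obtain ⟨rfl, rfl⟩ := Prod.mk.inj h
      exact Subfield.exists_pow_four_eq_two hb ha (Subfield.subset_closure (by simp))
        (Subfield.subset_closure (by simp)) (Subfield.subset_closure (by simp)) h₂ h₁ hab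
end

section
/- Let a₀, a₁, a₂, a₃ be nonzero integers such that the 2-adic valuations v₂(a₀), v₂(a₁), v₂(a₂), v₂(a₃) all have the same parity. Let r₁, r₂, r₃ ∈ ℂ satisfy r_j⁴ = a_j/a₀ for j = 1, 2, 3. Then no element x of the subfield of ℂ generated over ℚ by i, r₁, r₂, r₃ satisfies x⁴ = 2. -/
/-- In characteristic zero, over a field containing a primitive `n`-th root of unity, an `n`-th root
of an element of the base field which has nonzero trace lies in the base field. -/
theorem mem_range_algebraMap_of_trace_ne_zero {K L : Type*} [Field K] [CharZero K] [Field L]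
    [Algebra K L] [FiniteDimensional K L] {n : ℕ} (hn : 0 < n) {ζ : K} (hζ : IsPrimitiveRoot ζ n)
    {y : L} {b : K} (hy : y ^ n = algebraMap K L b) (htr : Algebra.trace K L y ≠ 0) :
    y ∈ Set.range (algebraMap K L) := by
  have : NeZero n := ⟨hn.ne'⟩
  let Ω := AlgebraicClosure K
  let σ₀ : L →ₐ[K] Ω := IsAlgClosed.lift
  have hy0 : y ≠ 0 := by
    rintro rfl
    simp at htr
  have hσ₀ : σ₀ y ≠ 0 := by simpa using hy0
  have hζΩ : IsPrimitiveRoot (algebraMap K Ω ζ) n :=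
    hζ.map_of_injective (algebraMap K Ω).injective
  have key : ∀ σ : L →ₐ[K] Ω, ∃ c : K, σ y = algebraMap K Ω c * σ₀ y := by
    intro σ
    have hpow : (σ y / σ₀ y) ^ n = 1 := by
      rw [div_pow, ← map_pow, ← map_pow, hy, AlgHom.commutes, AlgHom.commutes]
      refine div_self ?_
      rw [← AlgHom.commutes σ₀, ← hy, map_pow]
      exact pow_ne_zero _ hσ₀
    obtain ⟨k, -, hk⟩ := hζΩ.eq_pow_of_pow_eq_one hpow
    exact ⟨ζ ^ k, by rw [map_pow, hk, div_mul_cancel₀ _ hσ₀]⟩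
  choose c hc using key
  have hsum : algebraMap K Ω (Algebra.trace K L y) = algebraMap K Ω (∑ σ, c σ) * σ₀ y := by
    rw [trace_eq_sum_embeddings Ω, map_sum, Finset.sum_mul]
    exact Finset.sum_congr rfl fun σ _ => hc σ
  have hc0 : ∑ σ, c σ ≠ 0 := by
    intro h
    rw [h, map_zero, zero_mul, map_eq_zero] at hsum
    exact htr hsum
  refine ⟨Algebra.trace K L y / ∑ σ, c σ, σ₀.toRingHom.injective ?_⟩
  change σ₀ (algebraMap K L _) = σ₀ y
  rw [AlgHom.commutes, map_div₀, hsum, mul_div_cancel_left₀]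
  exact (map_ne_zero _).2 hc0

/-- Kummer theory: over a field containing a primitive `n`-th root of unity, if an `n`-th root `x`
lies in the extension generated by a finite set `S` of `n`-th roots, then `x` agrees
up to a factor in the base field with a product of elements of `S`. -/
theorem exists_mem_closure_div_mem_range {K E : Type*} [Field K] [CharZero K] [Field E]
    [Algebra K E] {n : ℕ} (hn : 0 < n) {ζ : K} (hζ : IsPrimitiveRoot ζ n) {S : Set E}
    (hS : S.Finite) (hSn : ∀ s ∈ S, s ^ n ∈ Set.range (algebraMap K E)) {x : E}
    (hx : x ∈ IntermediateField.adjoin K S) (hx0 : x ≠ 0)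
    (hxn : x ^ n ∈ Set.range (algebraMap K E)) :
    ∃ m ∈ Submonoid.closure S, m / x ∈ Set.range (algebraMap K E) := by
  have hint : ∀ s ∈ S, IsIntegral K s := fun s hs => by
    obtain ⟨b, hb⟩ := hSn s hs
    exact IsIntegral.of_pow hn (hb ▸ isIntegral_algebraMap)
  have : FiniteDimensional K (IntermediateField.adjoin K S) :=
    have := hS.to_subtype
    IntermediateField.finiteDimensional_adjoin hint
  have hadj : (IntermediateField.adjoin K S).toSubalgebra = Algebra.adjoin K S :=
    IntermediateField.adjoin_toSubalgebra_of_isAlgebraic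
      fun s hs => (hint s hs).isAlgebraic
  have hmem : ∀ m ∈ Submonoid.closure S, m ∈ IntermediateField.adjoin K S := fun m hm =>
    (Submonoid.closure_le (S := (IntermediateField.adjoin K S).toSubfield.toSubmonoid)).2
      (IntermediateField.subset_adjoin K S) hm
  have hpow : ∀ m ∈ Submonoid.closure S, m ^ n ∈ Set.range (algebraMap K E) := by
    intro m hm
    induction hm using Submonoid.closure_induction with
    | mem s hs => exact hSn s hs
    | one => exact ⟨1, by simp⟩
    | mul a b _ _ ha hb =>
      obtain ⟨u, hu⟩ := ha
      obtain ⟨v, hv⟩ := hb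
      exact ⟨u * v, by rw [map_mul, hu, hv, mul_pow]⟩
  by_contra! hcon
  let x' : IntermediateField.adjoin K S := ⟨x, hx⟩
  have hx'0 : x' ≠ 0 := fun h => hx0 (congrArg Subtype.val h)
  have hzero : ∀ z ∈ Submodule.span K (Submonoid.closure S : Set E),
      ∀ hz : z ∈ IntermediateField.adjoin K S,
        Algebra.trace K (IntermediateField.adjoin K S) (⟨z, hz⟩ / x') = 0 := by
    intro z hz
    have hspan : ∀ w ∈ Submodule.span K (Submonoid.closure S : Set E),
        w ∈ IntermediateField.adjoin K S := fun w hw => by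
      rw [← IntermediateField.mem_toSubalgebra, hadj, ← Subalgebra.mem_toSubmodule,
        Algebra.adjoin_eq_span]
      exact hw
    induction hz using Submodule.span_induction with
    | mem m hm =>
      intro hz
      by_contra htr
      obtain ⟨u, hu⟩ := hpow m hm
      obtain ⟨v, hv⟩ := hxn
      have hy : ((⟨m, hz⟩ / x' : IntermediateField.adjoin K S)) ^ n =
          algebraMap K (IntermediateField.adjoin K S) (u / v) := by
        apply Subtype.ext
        change (m / x) ^ n = algebraMap K E (u / v)
        rw [map_div₀, hu, hv, div_pow]
      obtain ⟨k, hk⟩ := mem_range_algebraMap_of_trace_ne_zero hn hζ hy htr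
      exact hcon m hm ⟨k, congrArg Subtype.val hk⟩
    | zero =>
      intro hz
      have : (⟨0, hz⟩ : IntermediateField.adjoin K S) = 0 := rfl
      rw [this, zero_div, map_zero]
    | add a b ha hb iha ihb =>
      intro hz
      have : (⟨a + b, hz⟩ : IntermediateField.adjoin K S) =
        ⟨a, hspan a ha⟩ + ⟨b, hspan b hb⟩ := rfl
      rw [this, add_div, map_add, iha, ihb, add_zero]
    | smul k a ha iha =>
      intro hz
      have : (⟨k • a, hz⟩ : IntermediateField.adjoin K S) = k • ⟨a, hspan a ha⟩ := rfl
      rw [this, smul_div_assoc, map_smul, iha, smul_zero]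
  have hxspan : x ∈ Submodule.span K (Submonoid.closure S : Set E) := by
    rw [← Algebra.adjoin_eq_span, Subalgebra.mem_toSubmodule, ← hadj]
    exact hx
  have h1 := hzero x hxspan hx
  rw [div_self hx'0, ← map_one (algebraMap K (IntermediateField.adjoin K S)),
    Algebra.trace_algebraMap, nsmul_one, Nat.cast_eq_zero] at h1
  exact Module.finrank_pos.ne' h1

theorem normSq_rat_add_rat_mul_I (u v : ℚ) :
    Complex.normSq (u + v * Complex.I) = u ^ 2 + v ^ 2 := by
  simp [Complex.normSq_apply]
  ring

/-- Elements of `ℚ(i)` have rational real and imaginary part. -/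
theorem exists_rat_add_rat_mul_I_s8 {y : ℂ} (hy : y ∈ IntermediateField.adjoin ℚ {Complex.I}) :
    ∃ u v : ℚ, y = u + v * Complex.I := by
  induction hy using IntermediateField.adjoin_induction with
  | mem s hs =>
    rw [Set.mem_singleton_iff] at hs
    exact ⟨0, 1, by simp [hs]⟩
  | algebraMap q => exact ⟨q, 0, by simp⟩
  | add a b _ _ ha hb =>
    obtain ⟨u, v, rfl⟩ := ha
    obtain ⟨s, t, rfl⟩ := hb
    exact ⟨u + s, v + t, by push_cast; ring⟩
  | inv a _ ha =>
    obtain ⟨u, v, rfl⟩ := ha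
    refine ⟨u / (u ^ 2 + v ^ 2), -v / (u ^ 2 + v ^ 2), ?_⟩
    rw [Complex.inv_def, normSq_rat_add_rat_mul_I]
    simp only [map_add, map_mul, Complex.conj_I, map_ratCast]
    push_cast
    ring
  | mul a b _ _ ha hb =>
    obtain ⟨u, v, rfl⟩ := ha
    obtain ⟨s, t, rfl⟩ := hb
    refine ⟨u * s - v * t, u * t + v * s, ?_⟩
    push_cast
    linear_combination (v * t : ℂ) * Complex.I_sq

/-- A rational number of even `2`-adic valuation is not twice a fourth power in `ℚ(i)`. -/
theorem ratCast_ne_two_mul_pow_four {q : ℚ} (hq0 : q ≠ 0) (hq : Even (padicValRat 2 q)) {y : ℂ}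
    (hy : y ∈ IntermediateField.adjoin ℚ {Complex.I}) : (q : ℂ) ≠ 2 * y ^ 4 := by
  intro h
  obtain ⟨u, v, rfl⟩ := exists_rat_add_rat_mul_I_s8 hy
  have hnorm := congrArg Complex.normSq h
  have hsq : q ^ 2 = 2 ^ 2 * (u ^ 2 + v ^ 2) ^ 4 := by
    have : ((q ^ 2 : ℚ) : ℝ) = ((2 ^ 2 * (u ^ 2 + v ^ 2) ^ 4 : ℚ) : ℝ) := by
      rw [map_mul, map_pow, normSq_rat_add_rat_mul_I, Complex.normSq_ratCast, Complex.normSq_ofNat] at hnorm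
      push_cast
      linear_combination hnorm
    exact_mod_cast this
  have hN : u ^ 2 + v ^ 2 ≠ 0 := by
    intro h0
    rw [h0] at hsq
    simp [hq0] at hsq
  have hval := congrArg (padicValRat 2) hsq
  rw [padicValRat.mul (by norm_num) (pow_ne_zero _ hN), padicValRat.pow, padicValRat.pow,
    padicValRat.pow, show (2 : ℚ) = ((2 : ℕ) : ℚ) by norm_num,
    padicValRat.self one_lt_two] at hval
  obtain ⟨k, hk⟩ := hq
  push_cast at hval
  omega

/-- A quotient of nonzero integers whose `2`-adic valuations have the same parity has even
`2`-adic valuation. -/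
theorem even_padicValRat_div {a b : ℤ} (ha : a ≠ 0) (hb : b ≠ 0)
    (h : padicValInt 2 b % 2 = padicValInt 2 a % 2) : Even (padicValRat 2 (a / b : ℚ)) := by
  rw [padicValRat.div (by exact_mod_cast ha) (by exact_mod_cast hb), padicValRat.of_int,
    padicValRat.of_int, Int.even_iff]
  omega

/-- Key step of Theorem 5.8: if the `2`-adic valuations of the nonzero integers
`a₀, a₁, a₂, a₃` all have the same parity, then
`ℚ(i, (a₁/a₀)^{1/4}, (a₂/a₀)^{1/4}, (a₃/a₀)^{1/4}) ⊆ ℂ` contains no fourth root of `2`. -/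
theorem stmt8 (a₀ a₁ a₂ a₃ : ℤ) (h₀ : a₀ ≠ 0) (h₁ : a₁ ≠ 0) (h₂ : a₂ ≠ 0) (h₃ : a₃ ≠ 0)
    (hpar₁ : padicValInt 2 a₀ % 2 = padicValInt 2 a₁ % 2)
    (hpar₂ : padicValInt 2 a₀ % 2 = padicValInt 2 a₂ % 2)
    (hpar₃ : padicValInt 2 a₀ % 2 = padicValInt 2 a₃ % 2)
    (r₁ r₂ r₃ : ℂ) (hr₁ : r₁ ^ 4 = (a₁ : ℂ) / (a₀ : ℂ))
    (hr₂ : r₂ ^ 4 = (a₂ : ℂ) / (a₀ : ℂ)) (hr₃ : r₃ ^ 4 = (a₃ : ℂ) / (a₀ : ℂ)) :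
    ∀ x ∈ Subfield.closure ({Complex.I, r₁, r₂, r₃} : Set ℂ), x ^ 4 ≠ 2 := by
  intro x hx hx4
  let K := IntermediateField.adjoin ℚ {Complex.I}
  let S : Set ℂ := {r₁, r₂, r₃}
  have hI : Complex.I ∈ K := IntermediateField.mem_adjoin_simple_self ℚ _
  have hζ : IsPrimitiveRoot (⟨Complex.I, hI⟩ : K) 4 :=
    IsPrimitiveRoot.of_map_of_injective (f := algebraMap K ℂ) Complex.isPrimitiveRoot_I
      (algebraMap K ℂ).injective
  have hS : ∀ s ∈ S, ∃ q : ℚ, q ≠ 0 ∧ Even (padicValRat 2 q) ∧ s ^ 4 = q := by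
    have hdiv : ∀ a : ℤ, a ≠ 0 → padicValInt 2 a₀ % 2 = padicValInt 2 a % 2 → ∀ s : ℂ,
        s ^ 4 = a / a₀ → ∃ q : ℚ, q ≠ 0 ∧ Even (padicValRat 2 q) ∧ s ^ 4 = q :=
      fun a ha hpar s hs => ⟨a / a₀, div_ne_zero (by exact_mod_cast ha) (by exact_mod_cast h₀),
        even_padicValRat_div ha h₀ hpar, by rw [hs]; push_cast; rfl⟩
    rintro s (rfl | rfl | rfl)
    · exact hdiv a₁ h₁ hpar₁ _ hr₁
    · exact hdiv a₂ h₂ hpar₂ _ hr₂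
    · exact hdiv a₃ h₃ hpar₃ _ hr₃
  have hrat : ∀ q : ℚ, (q : ℂ) ∈ Set.range (algebraMap K ℂ) := fun q => ⟨q, by simp⟩
  have hxL : x ∈ IntermediateField.adjoin K S := by
    refine (Subfield.closure_le (t := (IntermediateField.adjoin K S).toSubfield)).2 ?_ hx
    rintro s (rfl | hs)
    · exact (IntermediateField.adjoin K S).algebraMap_mem ⟨Complex.I, hI⟩
    · exact IntermediateField.subset_adjoin K S hs
  have hx0 : x ≠ 0 := by
    rintro rfl
    norm_num at hx4
  obtain ⟨m, hm, y, hy⟩ := exists_mem_closure_div_mem_range (by norm_num) hζ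
    (by simp [S] : S.Finite)
    (fun s hs => by obtain ⟨q, -, -, hq⟩ := hS s hs; exact hq ▸ hrat q) hxL hx0
    (by rw [hx4]; exact_mod_cast hrat 2)
  have hm4 : ∃ q : ℚ, q ≠ 0 ∧ Even (padicValRat 2 q) ∧ m ^ 4 = q := by
    clear hy
    induction hm using Submonoid.closure_induction with
    | mem s hs => exact hS s hs
    | one => exact ⟨1, one_ne_zero, by simp, by simp⟩
    | mul a b _ _ ha hb =>
      obtain ⟨p, hp0, hp, hap⟩ := ha
      obtain ⟨q, hq0, hq, hbq⟩ := hb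
      exact ⟨p * q, mul_ne_zero hp0 hq0, by rw [padicValRat.mul hp0 hq0]; exact hp.add hq,
        by rw [mul_pow, hap, hbq]; push_cast; rfl⟩
  obtain ⟨q, hq0, hq, hmq⟩ := hm4
  refine ratCast_ne_two_mul_pow_four hq0 hq y.2 ?_
  have hy' : (y : ℂ) = m / x := hy
  rw [hy', div_pow, hx4, hmq]
  ring
end

section
/- Let R = ℤ₂[X]/(X² − 2), where ℤ₂ is the ring of 2-adic integers, and let s denote the class of X (so s² = 2). There exists l ∈ R such that l⁴ = 1 − 8s(3 + 2s) and l² − (33 + 20s) ∈ 32sR (that is, l² ≡ 1 + 4√2 + 16√2 + 32 modulo 2⁵√2). -/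
open Polynomial

/-- The ring of integers `R = ℤ₂[X]/(X² − 2)` of `ℚ₂(√2)`, with `s` the class of `X`. -/
noncomputable abbrev R2 : Type := AdjoinRoot ((X : ℤ_[2][X]) ^ 2 - 2)

noncomputable abbrev s2 : R2 := AdjoinRoot.root ((X : ℤ_[2][X]) ^ 2 - 2)

theorem s2_sq : s2 ^ 2 = 2 := by
  have h := AdjoinRoot.eval₂_root ((X : ℤ_[2][X]) ^ 2 - 2)
  rw [eval₂_sub, eval₂_pow, eval₂_X, eval₂_ofNat] at h
  exact sub_eq_zero.mp h

theorem PadicInt.norm_two_mul_lt_one (x : ℤ_[2]) : ‖2 * x‖ < 1 := by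
  rw [← PadicInt.mem_nonunits, mem_nonunits_iff]
  intro h
  have h2 : IsUnit ((2 : ℕ) : ℤ_[2]) := isUnit_of_mul_isUnit_left h
  exact PadicInt.prime_p.not_isUnit h2

theorem PadicInt.isUnit_one_add_two_mul (x : ℤ_[2]) : IsUnit (1 + 2 * x) := by
  rw [PadicInt.isUnit_iff, IsUltrametricDist.norm_add_eq_max_of_norm_ne_norm]
  · simpa using (norm_two_mul_lt_one x).le
  · simpa using (norm_two_mul_lt_one x).ne'

theorem PadicInt.exists_add_two_mul_sq_eq (k x : ℤ_[2]) : ∃ y, y + 2 * k * y ^ 2 = x := by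
  have hd : ‖(1 + 2 * (2 * k * x) : ℤ_[2])‖ = 1 :=
    PadicInt.isUnit_iff.mp (isUnit_one_add_two_mul _)
  obtain ⟨y, hy, -⟩ := hensels_lemma (p := 2) (R := ℤ_[2])
    (F := X + C (2 * k) * X ^ 2 - C x) (a := x) (by
      have h1 : aeval x (X + C (2 * k) * X ^ 2 - C x : ℤ_[2][X]) = 2 * (k * x ^ 2) := by
        simp; ring
      have h2 : aeval x (derivative (X + C (2 * k) * X ^ 2 - C x : ℤ_[2][X])) =
          1 + 2 * (2 * k * x) := by
        simp; ring
      rw [h1, h2, hd, one_pow]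
      exact norm_two_mul_lt_one _)
  refine ⟨y, ?_⟩
  simpa [sub_eq_zero] using hy

/-- A solution in coordinates: `(u + f√2)² = a + b√2` and `(a + b√2)² = -31 - 24√2`. -/
theorem exists_coordinates : ∃ u f q r : ℤ_[2],
    u ^ 2 + 2 * f ^ 2 = 33 + 64 * q ∧ 2 * u * f = 20 + 32 * r ∧
    (33 + 64 * q) ^ 2 + 2 * (20 + 32 * r) ^ 2 = -31 ∧
    (33 + 64 * q) * (20 + 32 * r) = -12 := by
  obtain ⟨w, hw⟩ := PadicInt.exists_add_two_mul_sq_eq 8 (-3)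
  obtain ⟨p, hp⟩ := PadicInt.exists_add_two_mul_sq_eq 8 (-(1 + 4 * w ^ 2))
  obtain ⟨v, hv⟩ := PadicInt.exists_add_two_mul_sq_eq 4 w
  obtain ⟨g, hg⟩ := PadicInt.exists_add_two_mul_sq_eq 1 (2 * p + v)
  have hau := PadicInt.isUnit_one_add_two_mul (16 * p)
  have huu := PadicInt.isUnit_one_add_two_mul (2 * g)
  obtain ⟨i, hi⟩ := hau.exists_right_inv
  obtain ⟨j, hj⟩ := huu.exists_right_inv
  have ha : 1 + 2 * (16 * p) = 33 + 64 * (-1 - 2 * w ^ 2 - 8 * p ^ 2) := by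
    linear_combination 32 * hp
  have hb : -12 * i = 20 + 32 * (-1 + 12 * p * i) := by
    linear_combination -12 * hi
  have hsq : (1 + 2 * (16 * p)) ^ 2 = -15 + 16 * w := by
    linear_combination 64 * hp - 16 * hw
  have huq : (1 + 2 * (2 * g)) ^ 2 = 1 + 16 * p + 8 * v := by
    linear_combination 8 * hg
  have hn : (1 + 2 * (16 * p)) ^ 2 + 2 * (-12 * i) ^ 2 = -31 := by
    apply (hau.pow 2).mul_left_cancel
    linear_combination 288 * ((1 + 2 * (16 * p)) * i + 1) * hi +
      ((1 + 2 * (16 * p)) ^ 2 + 16 + 16 * w) * hsq + 16 * hw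
  refine ⟨1 + 2 * (2 * g), -6 * i * j, -1 - 2 * w ^ 2 - 8 * p ^ 2, -1 + 12 * p * i,
    ?_, ?_, ?_, ?_⟩
  · rw [← ha]
    have hf : 2 * (-6 * i * j) ^ 2 = 16 * p - 8 * v := by
      apply (huu.pow 2).mul_left_cancel
      apply mul_left_cancel₀ (show (4 : ℤ_[2]) ≠ 0 by norm_num)
      linear_combination 288 * i ^ 2 * ((1 + 2 * (2 * g)) * j + 1) * hj + hn + 32 * hv -
        2 * hsq - 4 * (16 * p - 8 * v) * huq
    linear_combination huq + hf
  · rw [← hb]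
    linear_combination -12 * i * hj
  · rwa [← ha, ← hb]
  · rw [← ha, ← hb]
    linear_combination -12 * hi

/-- Lemma 6.2: in `R = ℤ₂[X]/(X² − 2)` there is an `l` with `l⁴ = 1 − 8√2(3 + 2√2)`
and `l² ≡ 33 + 20√2 (= 1 + 4√2 + 16√2 + 32) mod 2⁵√2`. -/
theorem stmt11 : ∃ l : R2, l ^ 4 = 1 - 8 * s2 * (3 + 2 * s2) ∧
    ∃ r : R2, l ^ 2 - (33 + 20 * s2) = 32 * s2 * r := by
  obtain ⟨u, f, q, r, h₁, h₂, h₃, h₄⟩ := exists_coordinates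
  let φ := AdjoinRoot.of ((X : ℤ_[2][X]) ^ 2 - 2)
  replace h₁ := congrArg φ h₁
  replace h₂ := congrArg φ h₂
  replace h₃ := congrArg φ h₃
  replace h₄ := congrArg φ h₄
  simp only [map_add, map_mul, map_pow, map_neg, map_ofNat] at h₁ h₂ h₃ h₄
  have hs := s2_sq
  have hl : (φ u + φ f * s2) ^ 2 = (33 + 64 * φ q) + (20 + 32 * φ r) * s2 := by
    linear_combination h₁ + s2 * h₂ + φ f ^ 2 * hs
  refine ⟨φ u + φ f * s2, ?_, φ r + φ q * s2, ?_⟩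
  · rw [show 4 = 2 * 2 from rfl, pow_mul, hl]
    linear_combination h₃ + 2 * s2 * h₄ + ((20 + 32 * φ r) ^ 2 + 16) * hs
  · rw [hl]
    linear_combination -32 * φ q * hs
end

section
/- Let R = ℤ₂[X]/(X² − 2), where ℤ₂ is the ring of 2-adic integers, and let s denote the class of X (so s² = 2). Let l ∈ R satisfy l² − (33 + 20s) ∈ 32sR. Then there exist β, γ ∈ R such that l² + 1 = (1 + 2s)·β² and (1 + s)² − l² = (1 − s)·γ². -/
open Polynomial

theorem R2.exists_coords (x : R2) :
    ∃ a b : ℤ_[2], x = algebraMap ℤ_[2] R2 a + algebraMap ℤ_[2] R2 b * s2 := by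
  induction x using AdjoinRoot.induction_on with
  | ih p =>
    induction p using Polynomial.induction_on with
    | C a => exact ⟨a, 0, by simp [AdjoinRoot.algebraMap_eq]⟩
    | add p q hp hq =>
      obtain ⟨a, b, h⟩ := hp
      obtain ⟨c, d, h'⟩ := hq
      exact ⟨a + c, b + d, by rw [map_add, h, h', map_add, map_add]; ring⟩
    | monomial n a h =>
      obtain ⟨c, d, h⟩ := h
      refine ⟨2 * d, c, ?_⟩
      rw [pow_succ X n, ← mul_assoc, map_mul, h, AdjoinRoot.mk_X, map_mul, map_ofNat]
      linear_combination algebraMap ℤ_[2] R2 d * s2_sq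

theorem PadicInt.exists_unit_quartic_root (a b : ℤ_[2]) :
    ∃ c : ℤ_[2], IsUnit c ∧ c ^ 4 - (1 + 8 * a) * c ^ 2 + 32 * b ^ 2 = 0 := by
  have n2 : ‖(2 : ℤ_[2])‖ = 2⁻¹ := by simpa using PadicInt.norm_p (p := 2)
  let F : ℤ_[2][X] := X ^ 4 - C (1 + 8 * a) * X ^ 2 + C (32 * b ^ 2)
  have hF (c : ℤ_[2]) : aeval c F = c ^ 4 - (1 + 8 * a) * c ^ 2 + 32 * b ^ 2 := by
    simp [F]
  have hF' : aeval (1 : ℤ_[2]) (derivative F) = 2 * (1 - 2 * (4 * a)) := by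
    simp only [F, derivative_add, derivative_sub, derivative_C_mul, derivative_X_pow, derivative_C]
    simp
    ring
  have hunit : ‖1 - 2 * (4 * a)‖ = 1 := by
    have h : ‖-(2 * (4 * a))‖ < 1 := by
      rw [norm_neg, norm_mul, n2]
      linarith [PadicInt.norm_le_one (4 * a)]
    rw [sub_eq_add_neg, PadicInt.norm_add_eq_max_of_ne (by rw [norm_one]; exact h.ne'),
      norm_one, max_eq_left h.le]
  have h1 : ‖aeval (1 : ℤ_[2]) F‖ < ‖aeval (1 : ℤ_[2]) (derivative F)‖ ^ 2 := by
    have e : aeval (1 : ℤ_[2]) F = 2 ^ 3 * (4 * b ^ 2 - a) := by rw [hF]; ring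
    rw [hF', e, norm_mul, norm_mul, norm_pow, hunit, n2]
    linarith [PadicInt.norm_le_one (4 * b ^ 2 - a)]
  obtain ⟨c, hc, hlt, -⟩ := hensels_lemma h1
  refine ⟨c, ?_, by rw [← hF, hc]⟩
  have hlt1 : ‖c - 1‖ < 1 := by
    refine hlt.trans ?_
    rw [hF', norm_mul, hunit, n2]
    norm_num
  rw [PadicInt.isUnit_iff]
  have e : c = 1 + (c - 1) := by ring
  rw [e, PadicInt.norm_add_eq_max_of_ne (by rw [norm_one]; exact hlt1.ne'),
    norm_one, max_eq_left hlt1.le]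

theorem R2.exists_sq_eq_one_add_eight_mul (x : R2) : ∃ y : R2, 1 + 8 * x = y ^ 2 := by
  obtain ⟨a, b, rfl⟩ := R2.exists_coords x
  obtain ⟨c, hc, h⟩ := PadicInt.exists_unit_quartic_root a b
  obtain ⟨e, he⟩ := hc.exists_right_inv
  have key : c ^ 2 + 2 * (4 * b * e) ^ 2 = 1 + 8 * a := by
    linear_combination e ^ 2 * h + (1 + c * e) * (1 + 8 * a - c ^ 2) * he
  have key' : c * (4 * b * e) = 4 * b := by linear_combination 4 * b * he
  replace key := congrArg (algebraMap ℤ_[2] R2) key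
  replace key' := congrArg (algebraMap ℤ_[2] R2) key'
  simp only [map_add, map_mul, map_pow, map_one, map_ofNat] at key key'
  refine ⟨algebraMap ℤ_[2] R2 c + algebraMap ℤ_[2] R2 (4 * b * e) * s2, ?_⟩
  simp only [map_mul, map_ofNat]
  linear_combination -key - 2 * s2 * key' -
    (4 * algebraMap ℤ_[2] R2 b * algebraMap ℤ_[2] R2 e) ^ 2 * s2_sq

theorem R2.exists_seven_mul_eq_one : ∃ u : R2, 7 * u = 1 := by
  have h7 : IsUnit (7 : ℤ_[2]) := by
    rw [PadicInt.isUnit_iff]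
    exact_mod_cast (PadicInt.norm_natCast_eq_one_iff (p := 2) (n := 7)).mpr (by norm_num)
  obtain ⟨u, hu⟩ := h7.exists_right_inv
  exact ⟨algebraMap ℤ_[2] R2 u, by
    rw [← map_ofNat (algebraMap ℤ_[2] R2), ← map_mul, hu, map_one]⟩

/-- Formulae (6.3): if `l ∈ R = ℤ₂[X]/(X² − 2)` satisfies
`l² ≡ 33 + 20√2 mod 2⁵√2`, then `l² + 1 ∼ 1 + 2√2` and `(1+√2)² − l² ∼ 1 − √2`
up to squares in `R`. -/
theorem stmt12 (l : R2) (hl : ∃ r : R2, l ^ 2 - (33 + 20 * s2) = 32 * s2 * r) :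
    ∃ β γ : R2, l ^ 2 + 1 = (1 + 2 * s2) * β ^ 2 ∧
      (1 + s2) ^ 2 - l ^ 2 = (1 - s2) * γ ^ 2 := by
  obtain ⟨r, hr⟩ := hl
  obtain ⟨u, hu⟩ := R2.exists_seven_mul_eq_one
  obtain ⟨y, hy⟩ := R2.exists_sq_eq_one_add_eight_mul
    (s2 * (s2 + 1 + 2 * r) * ((2 * s2 - 1) * u))
  obtain ⟨z, hz⟩ := R2.exists_sq_eq_one_add_eight_mul (4 + 3 * s2 + 2 * s2 * r * (1 + s2))
  have hs := s2_sq
  generalize s2 = s at *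
  have hinv : (1 + 2 * s) * ((2 * s - 1) * u) = 1 := by
    linear_combination 4 * u * hs + hu
  refine ⟨s * y, s * z, ?_, ?_⟩
  · rw [mul_pow, ← hy, hs]
    linear_combination hr - 16 * s * (s + 1 + 2 * r) * hinv - 16 * hs
  · rw [mul_pow, ← hz, hs]
    linear_combination -hr + (49 + 32 * s * r) * hs
end

section
/- Let K be a field of characteristic ≠ 2 and let e, c ∈ K with e ≠ 0, c ≠ 0 and e + c ≠ 0. Then the quaternion algebra (e, c) over K is isomorphic as a K-algebra to the quaternion algebra (−ec, e + c) over K. -/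
open Quaternion

namespace QuaternionAlgebra.Basis

/-- In `(e, c)` the elements `k` and `i + j` satisfy the relations of `(-ec, e + c)`. -/
def kAddIJ {K : Type*} [Field K] (e c : K) : Basis ℍ[K, e, c] (-(e * c)) 0 (e + c) where
  i := ⟨0, 0, 0, 1⟩
  j := ⟨0, 1, 1, 0⟩
  k := ⟨0, c, -e, 0⟩
  i_mul_i := by ext <;> simp
  j_mul_j := by ext <;> simp
  i_mul_j := by ext <;> simp
  j_mul_i := by ext <;> simp

/-- The basis of `(-ec, e + c)` corresponding to the standard basis of `(e, c)` under `kAddIJ`. -/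
def kAddIJInv {K : Type*} [Field K] (e c : K) (hec : e + c ≠ 0) :
    Basis ℍ[K, -(e * c), e + c] e 0 c where
  i := ⟨0, 0, e / (e + c), 1 / (e + c)⟩
  j := ⟨0, 0, c / (e + c), -1 / (e + c)⟩
  k := ⟨0, 1, 0, 0⟩
  i_mul_i := by ext <;> simp <;> field_simp <;> ring
  j_mul_j := by ext <;> simp <;> field_simp <;> ring
  i_mul_j := by ext <;> simp <;> field_simp <;> ring
  j_mul_i := by ext <;> simp <;> field_simp <;> ring

end QuaternionAlgebra.Basis

open QuaternionAlgebra.Basis in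
/-- The isomorphism `(e, c) ≃ (-ec, e + c)`. -/
def QuaternionAlgebra.equivNegMulAdd {K : Type*} [Field K] (e c : K) (hec : e + c ≠ 0) :
    ℍ[K, e, c] ≃ₐ[K] ℍ[K, -(e * c), e + c] :=
  AlgEquiv.ofAlgHom (kAddIJInv e c hec).liftHom (kAddIJ e c).liftHom
    (by ext <;> simp [QuaternionAlgebra.Basis.lift, kAddIJ, kAddIJInv] <;> field_simp <;> ring)
    (by ext <;> simp [QuaternionAlgebra.Basis.lift, kAddIJ, kAddIJInv] <;> field_simp <;> ring)


/-- From the proof of Lemma 6.6: over a field `K` of characteristic `≠ 2`, for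
`e, c ∈ Kˣ` with `e + c ≠ 0`, the quaternion algebras `(e, c)` and `(−ec, e + c)`
are isomorphic as `K`-algebras. -/
theorem stmt13 {K : Type*} [Field K] (hchar : (2 : K) ≠ 0)
    (e c : K) (he : e ≠ 0) (hc : c ≠ 0) (hec : e + c ≠ 0) :
    Nonempty (ℍ[K, e, c] ≃ₐ[K] ℍ[K, -(e * c), e + c]) := by
  exact ⟨QuaternionAlgebra.equivNegMulAdd e c hec⟩
end

section
/- Over the field ℚ₂ of 2-adic numbers, the quaternion algebra (−1, −2) is a division algebra, while the quaternion algebra (−2, −7) is isomorphic as a ℚ₂-algebra to the algebra of 2×2 matrices over ℚ₂. -/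
open Quaternion

/-- A sum of four squares in `ℤ₂`, one of them `1`, is nonzero: this already holds modulo `8`. -/
theorem PadicInt.one_add_sq_add_sq_add_sq_ne_zero (x y z : ℤ_[2]) :
    1 + x ^ 2 + y ^ 2 + z ^ 2 ≠ 0 := by
  intro h
  have key : ∀ x y z : ZMod (2 ^ 3), 1 + x ^ 2 + y ^ 2 + z ^ 2 ≠ 0 := by decide
  apply key (PadicInt.toZModPow 3 x) (PadicInt.toZModPow 3 y) (PadicInt.toZModPow 3 z)
  simpa using congrArg (PadicInt.toZModPow 3) h

theorem Padic.eq_zero_of_sum_four_sq_eq_zero_of_norm_le {a b c d : ℚ_[2]}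
    (h : a ^ 2 + b ^ 2 + c ^ 2 + d ^ 2 = 0) (hb : ‖b‖ ≤ ‖a‖) (hc : ‖c‖ ≤ ‖a‖)
    (hd : ‖d‖ ≤ ‖a‖) : a = 0 := by
  by_contra ha
  have hle {x : ℚ_[2]} (hx : ‖x‖ ≤ ‖a‖) : ‖x / a‖ ≤ 1 := by
    rw [norm_div]
    exact div_le_one_of_le₀ hx (norm_nonneg a)
  apply PadicInt.one_add_sq_add_sq_add_sq_ne_zero ⟨b / a, hle hb⟩ ⟨c / a, hle hc⟩ ⟨d / a, hle hd⟩
  apply Subtype.ext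
  change 1 + (b / a) ^ 2 + (c / a) ^ 2 + (d / a) ^ 2 = 0
  field_simp
  simpa using h

theorem Padic.sum_four_sq_eq_zero {x : Fin 4 → ℚ_[2]} (h : ∑ i, x i ^ 2 = 0) : x = 0 := by
  obtain ⟨i, hi⟩ := Finite.exists_max fun i ↦ ‖x i‖
  suffices hxi : x i = 0 by
    ext j
    simpa [hxi] using hi j
  rw [Fin.sum_univ_four] at h
  fin_cases i
  · exact eq_zero_of_sum_four_sq_eq_zero_of_norm_le h (hi 1) (hi 2) (hi 3)
  · exact eq_zero_of_sum_four_sq_eq_zero_of_norm_le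
      (a := x 1) (b := x 0) (c := x 2) (d := x 3) (by linear_combination h) (hi 0) (hi 2) (hi 3)
  · exact eq_zero_of_sum_four_sq_eq_zero_of_norm_le
      (a := x 2) (b := x 0) (c := x 1) (d := x 3) (by linear_combination h) (hi 0) (hi 1) (hi 3)
  · exact eq_zero_of_sum_four_sq_eq_zero_of_norm_le
      (a := x 3) (b := x 0) (c := x 1) (d := x 2) (by linear_combination h) (hi 0) (hi 1) (hi 2)

/-- The norm form of the quaternion algebra `(-1, -2)` over `ℚ₂` is anisotropic. -/
theorem Padic.sq_add_sq_add_two_mul_ne_zero {x : ℍ[ℚ_[2], -1, -2]} (hx : x ≠ 0) :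
    x.re ^ 2 + x.imI ^ 2 + 2 * x.imJ ^ 2 + 2 * x.imK ^ 2 ≠ 0 := by
  intro h
  have h0 : ![x.re, x.imI, x.imJ + x.imK, x.imJ - x.imK] = 0 := by
    apply sum_four_sq_eq_zero
    simp only [Fin.sum_univ_four, Matrix.cons_val]
    linear_combination h
  have hr : x.re = 0 := congrFun h0 0
  have hi : x.imI = 0 := congrFun h0 1
  have hadd : x.imJ + x.imK = 0 := congrFun h0 2
  have hsub : x.imJ - x.imK = 0 := congrFun h0 3
  refine hx (QuaternionAlgebra.ext hr hi ?_ ?_)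
  · change x.imJ = 0
    linear_combination (hadd + hsub) / 2
  · change x.imK = 0
    linear_combination (hadd - hsub) / 2

/-- A quaternion of invertible norm is invertible. -/
theorem QuaternionAlgebra.isUnit_of_norm_ne_zero {K : Type*} [Field K] {a b : K} {x : ℍ[K, a, b]}
    (hx : x.re ^ 2 - a * x.imI ^ 2 - b * x.imJ ^ 2 + a * b * x.imK ^ 2 ≠ 0) : IsUnit x := by
  set n := x.re ^ 2 - a * x.imI ^ 2 - b * x.imJ ^ 2 + a * b * x.imK ^ 2 with hn
  have hmul : x * star x = n • 1 := by
    ext <;> simp [hn] <;> ring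
  have hmul' : star x * x = n • 1 := by
    ext <;> simp [hn] <;> ring
  refine isUnit_iff_exists.2 ⟨n⁻¹ • star x, ?_, ?_⟩
  · rw [mul_smul_comm, hmul, inv_smul_smul₀ hx]
  · rw [smul_mul_assoc, hmul', inv_smul_smul₀ hx]

theorem PadicInt.exists_sq_eq_neg_seven : ∃ s : ℤ_[2], s ^ 2 = -7 := by
  have hF : ‖(8 : ℤ_[2])‖ = 2⁻¹ ^ 3 := by
    rw [show (8 : ℤ_[2]) = (2 : ℕ) ^ 3 by norm_num, norm_pow, PadicInt.norm_p]
    norm_num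
  have hF' : ‖(2 : ℤ_[2])‖ = 2⁻¹ := by
    simpa using PadicInt.norm_p (p := 2)
  obtain ⟨s, hs, -⟩ := hensels_lemma (F := (Polynomial.X ^ 2 + 7 : Polynomial ℤ_[2])) (a := 1) (by
    have h8 : (Polynomial.X ^ 2 + 7 : Polynomial ℤ_[2]).aeval (1 : ℤ_[2]) = 8 := by
      simp
      norm_num
    have h2 : (Polynomial.X ^ 2 + 7 : Polynomial ℤ_[2]).derivative.aeval (1 : ℤ_[2]) = 2 := by
      simp
      norm_num
    rw [h8, h2, hF, hF']
    norm_num)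
  refine ⟨s, ?_⟩
  simp at hs
  linear_combination hs

/-- The matrices `!![0, a; 1, 0]` and `!![s, 0; 0, -s]` satisfy the relations of `(a, s²)`. -/
def QuaternionAlgebra.matrixBasis {K : Type*} [Field K] (a s : K) :
    QuaternionAlgebra.Basis (Matrix (Fin 2) (Fin 2) K) a 0 (s ^ 2) where
  i := !![0, a; 1, 0]
  j := !![s, 0; 0, -s]
  k := !![0, -(a * s); s, 0]
  i_mul_i := by ext i j; fin_cases i <;> fin_cases j <;> simp
  j_mul_j := by ext i j; fin_cases i <;> fin_cases j <;> simp [sq]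
  i_mul_j := by ext i j; fin_cases i <;> fin_cases j <;> simp
  j_mul_i := by ext i j; fin_cases i <;> fin_cases j <;> simp [mul_comm]

/-- The quaternion algebra `(a, s²)` is split. -/
theorem QuaternionAlgebra.nonempty_algEquiv_matrix {K : Type*} [Field K] [NeZero (2 : K)] {a s : K}
    (ha : a ≠ 0) (hs : s ≠ 0) : Nonempty (ℍ[K, a, s ^ 2] ≃ₐ[K] Matrix (Fin 2) (Fin 2) K) := by
  let f := (matrixBasis a s).liftHom
  have h2 : (2 : K) ≠ 0 := two_ne_zero
  have hinj : Function.Injective f := by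
    rw [injective_iff_map_eq_zero]
    intro x hx
    have h (i j : Fin 2) : f x i j = 0 := by rw [hx]; rfl
    have h00 := h 0 0
    have h01 := h 0 1
    have h10 := h 1 0
    have h11 := h 1 1
    simp [f, Basis.lift, matrixBasis, Matrix.algebraMap_matrix_apply] at h00 h01 h10 h11
    have hsub : x.imI - x.imK * s = 0 :=
      (mul_eq_zero_iff_left ha).1 (by linear_combination h01)
    have hr : x.re = 0 := (mul_eq_zero_iff_left h2).1 (by linear_combination h00 + h11)
    have hi : x.imI = 0 := (mul_eq_zero_iff_left h2).1 (by linear_combination hsub + h10)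
    have hj : x.imJ = 0 := (mul_eq_zero_iff_right hs).1 (by linear_combination h00 - hr)
    have hk : x.imK = 0 := (mul_eq_zero_iff_right hs).1 (by linear_combination h10 - hi)
    exact QuaternionAlgebra.ext hr hi hj hk
  exact ⟨AlgEquiv.ofBijective f ⟨hinj, (LinearMap.injective_iff_surjective_of_finrank_eq_finrank
    (f := f.toLinearMap) (by simp [finrank_eq_four, Module.finrank_matrix])).1 hinj⟩⟩

/-- End of the proof of Proposition 6.7: over `ℚ₂`, the quaternion algebra
`(−1, −2)` is a division algebra, while `(−2, −7)` is isomorphic to `M₂(ℚ₂)`. -/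
theorem stmt14 :
    (∀ x : ℍ[ℚ_[2], -1, -2], x ≠ 0 → IsUnit x) ∧
    Nonempty (ℍ[ℚ_[2], -2, -7] ≃ₐ[ℚ_[2]] Matrix (Fin 2) (Fin 2) ℚ_[2]) := by
  refine ⟨fun x hx ↦ QuaternionAlgebra.isUnit_of_norm_ne_zero ?_, ?_⟩
  · convert Padic.sq_add_sq_add_two_mul_ne_zero hx using 1
    ring
  · obtain ⟨s, hs⟩ := PadicInt.exists_sq_eq_neg_seven
    have hs' : (s : ℚ_[2]) ^ 2 = -7 := by exact_mod_cast congrArg ((↑) : ℤ_[2] → ℚ_[2]) hs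
    have hs0 : (s : ℚ_[2]) ≠ 0 := by
      rintro h
      norm_num [h] at hs'
    rw [← hs']
    exact QuaternionAlgebra.nonempty_algEquiv_matrix (by norm_num) hs0
end

section
/- Let F be a field of characteristic ≠ 2 and let t, x, y, z, w ∈ F with t ≠ 0 and z ≠ w, satisfying x² − y² = t(z² − w²) and t(x² + y²) = z² + w². Set u = (x − y)/(z − w) and v = (t³ − u²)·(x + y)/(t(z − w)). Then v² = (u² − t³)(t·u² − 1). -/
/-- Section 3: the substitution `u = (x−y)/(z−w)`, `v = (t³ − u²)(x+y)/(t(z−w))`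
carries points of the intersection of quadrics
`x² − y² = t(z² − w²)`, `t(x² + y²) = z² + w²` to points of the curve
`v² = (u² − t³)(tu² − 1)`. -/
theorem stmt16 {F : Type*} [Field F] (hchar : (2 : F) ≠ 0)
    (t x y z w : F) (ht : t ≠ 0) (hzw : z ≠ w)
    (h₁ : x ^ 2 - y ^ 2 = t * (z ^ 2 - w ^ 2))
    (h₂ : t * (x ^ 2 + y ^ 2) = z ^ 2 + w ^ 2)
    (u v : F) (hu : u = (x - y) / (z - w))
    (hv : v = (t ^ 3 - u ^ 2) * (x + y) / (t * (z - w))) :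
    v ^ 2 = (u ^ 2 - t ^ 3) * (t * u ^ 2 - 1) := by
  have hc : z - w ≠ 0 := sub_ne_zero.mpr hzw
  have key : (x + y) ^ 2 * (t ^ 3 * (z - w) ^ 2 - (x - y) ^ 2) =
      t ^ 2 * (z - w) ^ 2 * ((z - w) ^ 2 - t * (x - y) ^ 2) := by
    linear_combination 2 * t ^ 2 * (z - w) ^ 2 * h₂ -
      (x ^ 2 - y ^ 2 + t * (z ^ 2 - w ^ 2)) * h₁
  subst hu hv
  field_simp
  linear_combination (t ^ 3 * (z - w) ^ 2 - (x - y) ^ 2) * key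
end

section
/- Let F be a field and let u, v, t ∈ F with v ≠ 0, t² + 1 ≠ 0, and v² = (u² − t³)(t·u² − 1). Set c = (t² − 1)/(t² + 1), x = u²(t² − 1)²/v², and y = t(t² − 1)²·u·(u⁴ − t²)/((t² + 1)·v³). Then y² = x(x + 1)(x + c²). -/
/-- Lemma 3.1 (underlying identity): if `v² = (u² − t³)(tu² − 1)` with `v ≠ 0` and
`t² + 1 ≠ 0`, then setting `c = (t² − 1)/(t² + 1)`, `x = u²(t² − 1)²/v²` and
`y = t(t² − 1)² u (u⁴ − t²)/((t² + 1) v³)`, one has `y² = x(x + 1)(x + c²)`. -/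
theorem stmt17 {F : Type*} [Field F] (u v t : F) (hv : v ≠ 0) (ht : t ^ 2 + 1 ≠ 0)
    (h : v ^ 2 = (u ^ 2 - t ^ 3) * (t * u ^ 2 - 1))
    (c x y : F) (hc : c = (t ^ 2 - 1) / (t ^ 2 + 1))
    (hx : x = u ^ 2 * (t ^ 2 - 1) ^ 2 / v ^ 2)
    (hy : y = t * (t ^ 2 - 1) ^ 2 * u * (u ^ 4 - t ^ 2) / ((t ^ 2 + 1) * v ^ 3)) :
    y ^ 2 = x * (x + 1) * (x + c ^ 2) := by
  have h₁ : v ^ 2 + u ^ 2 * (t ^ 2 - 1) ^ 2 = t * (u ^ 2 - t) ^ 2 := by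
    rw [h]; ring
  have h₂ : v ^ 2 + u ^ 2 * (t ^ 2 + 1) ^ 2 = t * (u ^ 2 + t) ^ 2 := by
    rw [h]; ring
  have hx₁ : x + 1 = t * (u ^ 2 - t) ^ 2 / v ^ 2 := by
    rw [hx, ← h₁]; field_simp; ring
  have hx₂ : x + c ^ 2 =
      (t ^ 2 - 1) ^ 2 * (t * (u ^ 2 + t) ^ 2) / ((t ^ 2 + 1) ^ 2 * v ^ 2) := by
    rw [hx, hc, ← h₂]; field_simp; ring
  rw [hx₁, hx₂, hx, hy]
  field_simp
  ring
end
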